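/- arXiv:2507.12354 — 3 statements merged into one kernel-verified Lean document; each statement's English description precedes it below -/
import Mathlib

section
/- For every ε > 0 there exists an integer N such that the following holds for all n ≥ N. Let G be a graph on n vertices, set x := |G|/n² and suppose x ∈ [17/50, 7/20]. Suppose I ⊆ V(G) is an independent set, set α := |I|/n, and suppose α ∈ [17/100, 23/100] and d_G(v) ≥ α·n for every v ∈ I. Then N(S₂, G)/n³ ≤ max{ (α³ + (2x − α²)·(2x + α²)^{1/2})/2 , ((1 − 2x)^{3/2} + 4x − 1)/2 } + ε. -/
/-- A (simple) graph as a set of 2-element edges on `Fin n`. -/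
def IsGraph2 {n : ℕ} (G : Finset (Finset (Fin n))) : Prop := ∀ e ∈ G, e.card = 2

/-- The degree of a vertex in a graph given by its edge set. -/
def gdeg {n : ℕ} (G : Finset (Finset (Fin n))) (v : Fin n) : ℕ :=
  (G.filter fun e => v ∈ e).card

/-- The number of two-edge stars `S₂` (paths with two edges) in a graph:
`N(S₂, G) = ∑_v C(d_G(v), 2)`. -/
def numS2 {n : ℕ} (G : Finset (Finset (Fin n))) : ℕ :=
  ∑ v : Fin n, (gdeg G v).choose 2

/-- `I` is an independent set: no edge of `G` has both endpoints in `I`. -/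
def IndepSet {n : ℕ} (G : Finset (Finset (Fin n))) (I : Finset (Fin n)) : Prop :=
  ∀ e ∈ G, ¬ e ⊆ I

/-- The neighbours of `v` as a finset. -/
noncomputable def nbrs {V : Type*} [Fintype V] (H : SimpleGraph V) (v : V) : Finset V :=
  open Classical in Finset.univ.filter (H.Adj v)

/-- The number of neighbours of `v`. -/
noncomputable def ndeg {V : Type*} [Fintype V] (H : SimpleGraph V) (v : V) : ℕ :=
  (nbrs H v).card

theorem mem_nbrs {V : Type*} [Fintype V] {H : SimpleGraph V} {v w : V} :
    w ∈ nbrs H v ↔ H.Adj v w := by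
  simp [nbrs]

/-- The graph obtained from `H` by replacing the edges `vy` with `y ∈ M` by the edges `uy`. -/
def moveEdges {V : Type*} (H : SimpleGraph V) (u v : V) (M : Finset V) (huv : u ≠ v)
    (hM : ∀ y ∈ M, H.Adj v y ∧ ¬ H.Adj u y ∧ y ≠ u) : SimpleGraph V where
  Adj a b := (H.Adj a b ∧ ¬ (a = v ∧ b ∈ M) ∧ ¬ (b = v ∧ a ∈ M)) ∨ (a = u ∧ b ∈ M) ∨
    (b = u ∧ a ∈ M)
  symm := ⟨by
    rintro a b (⟨h, h1, h2⟩ | h | h)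
    · exact Or.inl ⟨h.symm, h2, h1⟩
    · exact Or.inr (Or.inr h)
    · exact Or.inr (Or.inl h)⟩
  loopless := ⟨by
    rintro a (⟨h, -, -⟩ | ⟨rfl, h⟩ | ⟨rfl, h⟩)
    · exact H.loopless.irrefl a h
    · exact (hM a h).2.2 rfl
    · exact (hM a h).2.2 rfl⟩

theorem ndeg_moveEdges {V : Type*} [Fintype V] [DecidableEq V] (H : SimpleGraph V) (u v : V)
    (M : Finset V) (huv : u ≠ v) (hM : ∀ y ∈ M, H.Adj v y ∧ ¬ H.Adj u y ∧ y ≠ u) (x : V) :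
    (ndeg (moveEdges H u v M huv hM) x : ℤ) =
      ndeg H x + (if x = u then (M.card : ℤ) else 0) - (if x = v then (M.card : ℤ) else 0) := by
  have hvM : v ∉ M := fun h => H.loopless.irrefl v (hM v h).1
  have huM : u ∉ M := fun h => (hM u h).2.2 rfl
  by_cases hxu : x = u
  · subst hxu
    have h : nbrs (moveEdges H x v M huv hM) x = nbrs H x ∪ M := by
      ext y
      simp only [mem_nbrs, moveEdges, Finset.mem_union]
      grind
    have hd : Disjoint (nbrs H x) M := by
      rw [Finset.disjoint_left]
      intro y hy hyM
      exact (hM y hyM).2.1 (mem_nbrs.1 hy)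
    simp [ndeg, h, Finset.card_union_of_disjoint hd, huv]
  by_cases hxv : x = v
  · subst hxv
    have h : nbrs (moveEdges H u x M huv hM) x = nbrs H x \ M := by
      ext y
      simp only [mem_nbrs, moveEdges, Finset.mem_sdiff]
      grind
    have hs : M ⊆ nbrs H x := fun y hy => mem_nbrs.2 (hM y hy).1
    simp [ndeg, h, Finset.card_sdiff_of_subset hs, hxu, Nat.cast_sub (Finset.card_le_card hs)]
  by_cases hxM : x ∈ M
  · have h : nbrs (moveEdges H u v M huv hM) x = insert u ((nbrs H x).erase v) := by
      ext y
      simp only [mem_nbrs, moveEdges, Finset.mem_insert, Finset.mem_erase]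
      grind
    have hv : v ∈ nbrs H x := mem_nbrs.2 (hM x hxM).1.symm
    have hu : u ∉ (nbrs H x).erase v := by
      simp only [Finset.mem_erase, mem_nbrs, not_and]
      intro _ h
      exact (hM x hxM).2.1 h.symm
    have := Finset.card_erase_add_one hv
    simp [ndeg, h, Finset.card_insert_of_notMem hu, hxu, hxv]
    omega
  · have h : nbrs (moveEdges H u v M huv hM) x = nbrs H x := by
      ext y
      simp only [mem_nbrs, moveEdges]
      grind
    simp [ndeg, h, hxu, hxv]

/-- `I` is an independent set of `b` vertices, each of degree at least `b`. -/
def IndepPair {V : Type*} [Fintype V] (b : ℕ) (H : SimpleGraph V) (I : Finset V) : Prop :=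
  I.card = b ∧ (∀ v ∈ I, ∀ w ∈ I, ¬ H.Adj v w) ∧ ∀ v ∈ I, b ≤ ndeg H v

/-- The pair `(H, I)` maximises the sum of squared degrees for its sum of degrees. -/
def IsMaxPair {V : Type*} [Fintype V] (b : ℕ) (H : SimpleGraph V) (I : Finset V) : Prop :=
  IndepPair b H I ∧ ∀ (H' : SimpleGraph V) (I' : Finset V), IndepPair b H' I' →
    ∑ v, ndeg H' v = ∑ v, ndeg H v → ∑ v, ndeg H' v ^ 2 ≤ ∑ v, ndeg H v ^ 2

theorem IndepPair.exists_isMaxPair {V : Type*} [Fintype V] {b : ℕ} {H : SimpleGraph V}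
    {I : Finset V} (h : IndepPair b H I) :
    ∃ (H' : SimpleGraph V) (I' : Finset V), IsMaxPair b H' I' ∧
      ∑ v, ndeg H' v = ∑ v, ndeg H v ∧ ∑ v, ndeg H v ^ 2 ≤ ∑ v, ndeg H' v ^ 2 := by
  classical
  let F : Set (SimpleGraph V × Finset V) :=
    {p | IndepPair b p.1 p.2 ∧ ∑ v, ndeg p.1 v = ∑ v, ndeg H v}
  obtain ⟨p, hp, hmax⟩ := Set.exists_max_image F (fun p => ∑ v, ndeg p.1 v ^ 2)
    (Set.toFinite F) ⟨(H, I), h, rfl⟩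
  refine ⟨p.1, p.2, ⟨hp.1, fun H' I' h' hs => ?_⟩, hp.2, hmax (H, I) ⟨h, rfl⟩⟩
  exact hmax (H', I') ⟨h', hs.trans hp.2⟩

theorem IsMaxPair.ndeg_add_card_le {V : Type*} [Fintype V] {b : ℕ} {H : SimpleGraph V}
    {I : Finset V} (h : IsMaxPair b H I) {u v : V} {M : Finset V} (hMne : M.Nonempty)
    (huv : u ≠ v) (hM : ∀ y ∈ M, H.Adj v y ∧ ¬ H.Adj u y ∧ y ≠ u)
    (hu : u ∈ I → ∀ y ∈ M, y ∉ I) (hv : v ∈ I → b + M.card ≤ ndeg H v) :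
    ndeg H u + M.card ≤ ndeg H v := by
  classical
  have hd := ndeg_moveEdges H u v M huv hM
  have hsum : ∑ x, ndeg (moveEdges H u v M huv hM) x = ∑ x, ndeg H x := by
    have : (∑ x, ndeg (moveEdges H u v M huv hM) x : ℤ) = ∑ x, (ndeg H x : ℤ) := by
      simp [hd, Finset.sum_add_distrib]
    exact_mod_cast this
  have hsq : (∑ x, (ndeg (moveEdges H u v M huv hM) x : ℤ) ^ 2) =
      ∑ x, (ndeg H x : ℤ) ^ 2 + 2 * M.card * (ndeg H u - ndeg H v + M.card) := by
    have : ∀ x, (ndeg (moveEdges H u v M huv hM) x : ℤ) ^ 2 = (ndeg H x : ℤ) ^ 2 +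
        (if x = u then (2 * ndeg H u * M.card + M.card ^ 2 : ℤ) else 0) +
        (if x = v then (-2 * ndeg H v * M.card + M.card ^ 2 : ℤ) else 0) := by
      intro x
      rw [hd]
      by_cases h1 : x = u
      · subst h1; simp [huv]; ring
      · by_cases h2 : x = v
        · subst h2; simp [h1]; ring
        · simp [h1, h2]
    simp only [this, Finset.sum_add_distrib, Finset.sum_ite_eq', Finset.mem_univ, if_true]
    ring
  have hfeas : IndepPair b (moveEdges H u v M huv hM) I := by
    refine ⟨h.1.1, ?_, ?_⟩
    · rintro x hx y hy (⟨hxy, -⟩ | ⟨rfl, hyM⟩ | ⟨rfl, hxM⟩)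
      · exact h.1.2.1 x hx y hy hxy
      · exact hu hx y hyM hy
      · exact hu hy x hxM hx
    · intro x hx
      have h1 := hd x
      have h2 := h.1.2.2 x hx
      split_ifs at h1 with h3 h4 h4
      · exact absurd (h3.symm.trans h4) huv
      · omega
      · subst h4
        have := hv hx
        omega
      · omega
  have hle := h.2 _ I hfeas hsum
  have hle' : (∑ x, (ndeg (moveEdges H u v M huv hM) x : ℤ) ^ 2) ≤ ∑ x, (ndeg H x : ℤ) ^ 2 := by
    exact_mod_cast hle
  rw [hsq] at hle'
  have hpos : (0 : ℤ) < M.card := by exact_mod_cast hMne.card_pos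
  have : (ndeg H u - ndeg H v + M.card : ℤ) ≤ 0 := by
    by_contra! hc
    have := mul_pos hpos hc
    linarith
  omega

theorem IsMaxPair.adj_of_ndeg_le {V : Type*} [Fintype V] {b : ℕ} {H : SimpleGraph V}
    {I : Finset V} (h : IsMaxPair b H I) {u v y : V} (hu : u ∉ I) (hv : v ∉ I)
    (hd : ndeg H v ≤ ndeg H u) (hy : H.Adj v y) (hyu : y ≠ u) : H.Adj u y := by
  by_contra hn
  have huv : u ≠ v := by rintro rfl; exact hn hy
  have := h.ndeg_add_card_le (M := {y}) ⟨y, by simp⟩ huv (by simp [hy, hn, hyu])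
    (fun h => absurd h hu) (fun h => absurd h hv)
  simp at this
  omega

open Classical in
/-- The vertices outside `I` that are adjacent to every vertex outside `I` of at least their own
degree. -/
noncomputable def core {V : Type*} [Fintype V] (H : SimpleGraph V) (I : Finset V) : Finset V :=
  Finset.univ.filter fun u => u ∉ I ∧ ∀ w, w ∉ I → w ≠ u → ndeg H u ≤ ndeg H w → H.Adj u w

theorem mem_core {V : Type*} [Fintype V] {H : SimpleGraph V} {I : Finset V} {u : V} :
    u ∈ core H I ↔ u ∉ I ∧ ∀ w, w ∉ I → w ≠ u → ndeg H u ≤ ndeg H w → H.Adj u w := by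
  simp [core]

theorem adj_of_mem_core {V : Type*} [Fintype V] {H : SimpleGraph V} {I : Finset V} {u v : V}
    (hu : u ∈ core H I) (hv : v ∈ core H I) (huv : u ≠ v) : H.Adj u v := by
  rcases le_total (ndeg H u) (ndeg H v) with hd | hd
  · exact (mem_core.1 hu).2 v (mem_core.1 hv).1 huv.symm hd
  · exact ((mem_core.1 hv).2 u (mem_core.1 hu).1 huv hd).symm

section IsMaxPair

variable {V : Type*} [Fintype V] {b : ℕ} {H : SimpleGraph V} {I : Finset V}

theorem IsMaxPair.mem_core_of_ndeg_le (h : IsMaxPair b H I) {u w : V} (hu : u ∈ core H I)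
    (hw : w ∉ I) (hd : ndeg H u ≤ ndeg H w) : w ∈ core H I := by
  refine mem_core.2 ⟨hw, fun w' hw' hne hd' => ?_⟩
  have hu' := mem_core.1 hu
  by_cases hwu : w = u
  · subst hwu
    exact hu'.2 w' hw' hne hd'
  by_cases h1 : w' = u
  · subst h1
    exact (hu'.2 w hw hwu hd).symm
  · exact h.adj_of_ndeg_le hw hu'.1 hd (hu'.2 w' hw' h1 (hd.trans hd')) hne

theorem IsMaxPair.not_adj_of_notMem_core (h : IsMaxPair b H I) {u v : V} (huI : u ∉ I)
    (hvI : v ∉ I) (hu : u ∉ core H I) (hv : v ∉ core H I) : ¬ H.Adj u v := by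
  wlog hd : ndeg H v ≤ ndeg H u generalizing u v
  · exact fun ha => this hvI huI hv hu (le_of_not_ge hd) ha.symm
  intro ha
  simp only [mem_core, huI, not_false_eq_true, true_and, not_forall] at hu
  obtain ⟨w, hw, hne, hdw, hnw⟩ := hu
  exact hnw (h.adj_of_ndeg_le hw hvI (hd.trans hdw) ha.symm hne.symm).symm

theorem IsMaxPair.ndeg_le_of_mem_core (h : IsMaxPair b H I) {k w : V} (hk : k ∈ core H I)
    (hwI : w ∉ I) (hw : w ∉ core H I) : ndeg H w ≤ ndeg H k := by
  by_contra! hc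
  exact hw (h.mem_core_of_ndeg_le hk hwI hc.le)

theorem IsMaxPair.adj_core (h : IsMaxPair b H I) {k v w : V} (hk : k ∈ core H I)
    (hwI : w ∉ I) (hw : w ∉ core H I) (hvw : H.Adj v w) (hvk : v ≠ k) : H.Adj v k :=
  (h.adj_of_ndeg_le (mem_core.1 hk).1 hwI (h.ndeg_le_of_mem_core hk hwI hw) hvw.symm hvk).symm

theorem IsMaxPair.notMem_of_adj (h : IsMaxPair b H I) {v w : V} (hv : v ∈ I) (hvw : H.Adj v w) :
    w ∉ I := fun hw => h.1.2.1 v hv w hw hvw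

theorem IsMaxPair.le_card_core (h : IsMaxPair b H I) (h2b : 2 * b ≤ Fintype.card V)
    (hcount : 4 * b * Fintype.card V < ∑ v, ndeg H v + 5 * b ^ 2) : b ≤ (core H I).card := by
  classical
  by_contra! hc
  set K := core H I with hK
  set n := Fintype.card V with hn
  have hdisj : Disjoint K I := by
    rw [Finset.disjoint_left]
    exact fun x hx => (mem_core.1 hx).1
  set J := (K ∪ I)ᶜ with hJ
  have hcard : K.card + b + J.card = n := by
    have := Finset.card_add_card_compl (K ∪ I)
    rwa [Finset.card_union_of_disjoint hdisj, h.1.1] at this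
  have hsplit : ∑ v, ndeg H v = ∑ v ∈ K, ndeg H v + ∑ v ∈ I, ndeg H v + ∑ v ∈ J, ndeg H v := by
    rw [← Finset.sum_union hdisj, hJ, Finset.sum_add_sum_compl]
  have h1 : ∑ v ∈ K, ndeg H v ≤ K.card * n := by
    rw [← smul_eq_mul]
    exact Finset.sum_le_card_nsmul _ _ _ fun v _ => Finset.card_le_univ _
  have h2 : ∑ v ∈ I, ndeg H v ≤ I.card * (K.card + J.card) := by
    rw [← smul_eq_mul]
    refine Finset.sum_le_card_nsmul _ _ _ fun v hv => ?_
    refine (Finset.card_le_card (t := K ∪ J) fun w hw => ?_).trans (Finset.card_union_le _ _)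
    have := h.notMem_of_adj hv (mem_nbrs.1 hw)
    simp [hJ, this, em]
  have h3 : ∑ v ∈ J, ndeg H v ≤ J.card * (K.card + I.card) := by
    rw [← smul_eq_mul]
    refine Finset.sum_le_card_nsmul _ _ _ fun v hv => ?_
    refine (Finset.card_le_card (t := K ∪ I) fun w hw => ?_).trans (Finset.card_union_le _ _)
    by_contra hw'
    simp only [hJ, Finset.mem_compl, Finset.mem_union, not_or] at hv hw'
    exact h.not_adj_of_notMem_core hv.2 hw'.2 hv.1 hw'.1 (mem_nbrs.1 hw)
  rw [h.1.1] at h2 h3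
  zify at *
  have hJc : (J.card : ℤ) = n - b - K.card := by linarith
  rw [hJc] at h2 h3
  nlinarith [mul_nonneg (sub_nonneg.2 hc.le) (sub_nonneg.2 h2b), sq_nonneg ((b : ℤ) - K.card)]

theorem IsMaxPair.exists_subset_core (h : IsMaxPair b H I) (hb : 2 ≤ b)
    (hc : b ≤ (core H I).card) :
    ∃ S ⊆ core H I, S.card = b ∧ ∀ s ∈ S, ∀ v ∈ I, H.Adj s v := by
  classical
  have hI : I.Nonempty := by
    rw [← Finset.card_pos, h.1.1]; omega
  obtain ⟨v₀, hv₀, hmin⟩ := Finset.exists_min_image I (ndeg H) hI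
  have hbig : b ≤ (nbrs H v₀ ∩ core H I).card := by
    by_cases hJ : ∃ w, H.Adj v₀ w ∧ w ∉ core H I
    · obtain ⟨w, hvw, hw⟩ := hJ
      rw [Finset.inter_eq_right.2]
      · exact hc
      · intro k hk
        refine mem_nbrs.2 (h.adj_core hk (h.notMem_of_adj hv₀ hvw) hw hvw ?_)
        rintro rfl
        exact (mem_core.1 hk).1 hv₀
    · push Not at hJ
      rw [Finset.inter_eq_left.2 fun w hw => hJ w (mem_nbrs.1 hw)]
      exact h.1.2.2 v₀ hv₀
  obtain ⟨S, hS, hSb⟩ := Finset.exists_subset_card_eq hbig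
  refine ⟨S, hS.trans Finset.inter_subset_right, hSb, fun s hs v hv => ?_⟩
  have hs' := Finset.mem_inter.1 (hS hs)
  have hsI := (mem_core.1 hs'.2).1
  by_contra hn
  obtain ⟨s', hs1, hs2⟩ : ∃ s' ∈ nbrs H v, s' ∉ nbrs H v₀ := by
    by_contra! hsub
    have : nbrs H v = nbrs H v₀ := Finset.eq_of_subset_of_card_le hsub (hmin v hv)
    exact hn (mem_nbrs.1 (this ▸ hs'.1)).symm
  have hs1' := mem_nbrs.1 hs1
  have hs2' : ¬ H.Adj v₀ s' := fun h => hs2 (mem_nbrs.2 h)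
  have hs'I := h.notMem_of_adj hv hs1'
  rcases le_total (ndeg H s') (ndeg H s) with hd | hd
  · refine hn (h.adj_of_ndeg_le hsI hs'I hd hs1'.symm ?_)
    rintro rfl; exact hsI hv
  · refine hs2' (h.adj_of_ndeg_le hs'I hsI hd (mem_nbrs.1 hs'.1).symm ?_).symm
    rintro rfl; exact hs'I hv₀

/-- A vertex of `I` with a neighbour outside `I` and the core dominates the vertices outside both,
and has at least as many neighbours there as there are such vertices of `I`. -/
theorem IsMaxPair.exceptional (h : IsMaxPair b H I) (hc : b ≤ (core H I).card) {I₁ : Finset V}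
    (hI₁ : ∀ v, v ∈ I₁ ↔ v ∈ I ∧ ∃ w, H.Adj v w ∧ w ∉ core H I) {v : V} (hv : v ∈ I₁) :
    (∀ w, w ∉ I → w ∉ core H I → ndeg H w < ndeg H v) ∧
      (core H I).card + I₁.card ≤ ndeg H v := by
  classical
  set J := (core H I ∪ I)ᶜ with hJ
  have memJ : ∀ w, w ∈ J ↔ w ∉ I ∧ w ∉ core H I := by
    intro w; simp [hJ, and_comm]
  have hne : ∀ x ∈ I, ∀ k ∈ core H I, x ≠ k := by
    rintro x hx k hk rfl; exact (mem_core.1 hk).1 hx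
  have hexJ : ∀ x ∈ I₁, ∃ w ∈ J, H.Adj x w := by
    intro x hx
    obtain ⟨hxI, w, hxw, hw⟩ := (hI₁ x).1 hx
    exact ⟨w, (memJ w).2 ⟨h.notMem_of_adj hxI hxw, hw⟩, hxw⟩
  have hJne : J.Nonempty := by
    obtain ⟨w, hw, -⟩ := hexJ v hv
    exact ⟨w, hw⟩
  obtain ⟨w₀, hw₀, hmax⟩ := Finset.exists_max_image J (ndeg H) hJne
  have hw₀' := (memJ w₀).1 hw₀
  have hadj₀ : ∀ x ∈ I₁, H.Adj x w₀ := by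
    intro x hx
    obtain ⟨w, hw, hxw⟩ := hexJ x hx
    refine (h.adj_of_ndeg_le hw₀'.1 ((memJ w).1 hw).1 (hmax w hw) hxw.symm ?_).symm
    rintro rfl; exact hw₀'.1 ((hI₁ x).1 hx).1
  have hcard : ∀ x ∈ I₁, b + 1 ≤ ndeg H x := by
    intro x hx
    have hsub : insert w₀ (core H I) ⊆ nbrs H x := by
      intro k hk
      rcases Finset.mem_insert.1 hk with rfl | hk
      · exact mem_nbrs.2 (hadj₀ x hx)
      · exact mem_nbrs.2 (h.adj_core hk hw₀'.1 hw₀'.2 (hadj₀ x hx) (hne x ((hI₁ x).1 hx).1 k hk))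
    have := Finset.card_le_card hsub
    rw [Finset.card_insert_of_notMem hw₀'.2] at this
    exact (by omega : b + 1 ≤ (core H I).card + 1).trans this
  have hvI := ((hI₁ v).1 hv).1
  have key : ∀ w, w ∉ I → w ≠ w₀ → ¬ H.Adj w₀ w → ndeg H w < ndeg H v := by
    intro w hwI hne hnadj
    have := h.ndeg_add_card_le (u := w) (v := v) (M := {w₀}) ⟨w₀, by simp⟩
      (by rintro rfl; exact hwI hvI)
      (by
        intro y hy
        rw [Finset.mem_singleton] at hy
        subst hy
        exact ⟨hadj₀ v hv, fun h => hnadj h.symm, hne.symm⟩)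
      (fun h => absurd h hwI) (by simpa using fun _ => hcard v hv)
    simpa using this
  have hI₁sub : ∀ x, x ∈ I₁ → x ∉ core H I := fun x hx hk => (mem_core.1 hk).1 ((hI₁ x).1 hx).1
  have hdisj : Disjoint (core H I) I₁ := by
    rw [Finset.disjoint_left]
    exact fun x hx hx' => hI₁sub x hx' hx
  obtain ⟨w', hw'I, hw'ne, hw'd, hw'n⟩ :
      ∃ w, w ∉ I ∧ w ≠ w₀ ∧ ndeg H w₀ ≤ ndeg H w ∧ ¬ H.Adj w₀ w := by
    have := hw₀'.2
    simp only [mem_core, hw₀'.1, not_false_eq_true, true_and, not_forall] at this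
    obtain ⟨w, h1, h2, h3, h4⟩ := this
    exact ⟨w, h1, h2, h3, h4⟩
  have hlt := key w' hw'I hw'ne hw'n
  refine ⟨fun w hwI hw => (hmax w ((memJ w).2 ⟨hwI, hw⟩)).trans_lt (hw'd.trans_lt hlt), ?_⟩
  by_cases hall : ∀ k ∈ core H I, H.Adj w₀ k
  · have hsub : core H I ∪ I₁ ⊆ nbrs H w₀ := by
      intro x hx
      rcases Finset.mem_union.1 hx with hx | hx
      · exact mem_nbrs.2 (hall x hx)
      · exact mem_nbrs.2 (hadj₀ x hx).symm
    have := Finset.card_le_card hsub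
    rw [Finset.card_union_of_disjoint hdisj] at this
    exact this.trans (hw'd.trans hlt.le)
  · push Not at hall
    obtain ⟨k, hk, hkn⟩ := hall
    have hkI := (mem_core.1 hk).1
    have hlt := key k hkI (by rintro rfl; exact hw₀'.2 hk) hkn
    have hsub : (core H I).erase k ∪ I₁ ⊆ nbrs H k := by
      intro x hx
      rcases Finset.mem_union.1 hx with hx | hx
      · have hx' := Finset.mem_erase.1 hx
        exact mem_nbrs.2 (adj_of_mem_core hk hx'.2 hx'.1.symm)
      · refine mem_nbrs.2 (h.adj_core hk hw₀'.1 hw₀'.2 (hadj₀ x hx) ?_).symm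
        exact hne x ((hI₁ x).1 hx).1 k hk
    have h1 := Finset.card_le_card hsub
    rw [Finset.card_union_of_disjoint (hdisj.mono_left (Finset.erase_subset _ _))] at h1
    have h2 := Finset.card_erase_add_one hk
    have h3 : (nbrs H k).card = ndeg H k := rfl
    omega

theorem IsMaxPair.exists_split [DecidableEq V] (h : IsMaxPair b H I) (hb : 2 ≤ b)
    (hc : b ≤ (core H I).card) :
    ∃ K S : Finset V, (∀ u ∈ K, ∀ v ∈ K, u ≠ v → H.Adj u v) ∧
      (∀ u, u ∉ K → ∀ v, v ∉ K → ¬ H.Adj u v) ∧ S ⊆ K ∧ S.card = b ∧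
      ∀ s ∈ S, b ≤ (nbrs H s ∩ Kᶜ).card := by
  classical
  obtain ⟨S, hSK, hSb, hSI⟩ := h.exists_subset_core hb hc
  set K := core H I with hK
  set I₁ := I.filter (fun v => ∃ w, H.Adj v w ∧ w ∉ K) with hI₁def
  have hI₁ : ∀ v, v ∈ I₁ ↔ v ∈ I ∧ ∃ w, H.Adj v w ∧ w ∉ core H I := by
    intro v; simp [hI₁def, hK]
  have hKI : ∀ x ∈ K, x ∉ I := fun x hx => (mem_core.1 hx).1
  have hclique : ∀ u ∈ K, ∀ v ∈ K, u ≠ v → H.Adj u v := fun u hu v hv => adj_of_mem_core hu hv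
  -- the edges outside the core join `I₁` to vertices outside `I`
  have hout : ∀ u, u ∉ K → ∀ v, v ∉ K → H.Adj u v → (u ∈ I₁ ∧ v ∉ I) ∨ (v ∈ I₁ ∧ u ∉ I) := by
    intro u hu v hv huv
    by_cases huI : u ∈ I
    · exact Or.inl ⟨(hI₁ u).2 ⟨huI, v, huv, hv⟩, h.notMem_of_adj huI huv⟩
    · by_cases hvI : v ∈ I
      · exact Or.inr ⟨(hI₁ v).2 ⟨hvI, u, huv.symm, hu⟩, huI⟩
      · exact absurd huv (h.not_adj_of_notMem_core huI hvI hu hv)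
  have hI₁K : ∀ v ∈ I₁, ∀ k ∈ K, H.Adj v k := by
    intro v hv k hk
    obtain ⟨hvI, w, hvw, hw⟩ := (hI₁ v).1 hv
    refine h.adj_core hk (h.notMem_of_adj hvI hvw) hw hvw ?_
    rintro rfl; exact hKI _ hk hvI
  have hSJ : ∀ v ∈ I₁, ∀ w, w ∉ K → H.Adj v w → ∀ s ∈ S, H.Adj s w := by
    intro v hv w hwK hvw s hs
    by_contra hn
    have hvI := ((hI₁ v).1 hv).1
    have hsK := hSK hs
    set M := nbrs H v \ insert s (nbrs H s) with hM
    have hMsub : M ⊆ nbrs H v := Finset.sdiff_subset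
    have hsw : w ≠ s := by rintro rfl; exact hwK hsK
    have hKM : K ⊆ nbrs H v \ M := by
      intro k hk
      have h1 := hI₁K v hv k hk
      simp only [hM, Finset.mem_sdiff, mem_nbrs, h1, Finset.mem_insert, true_and, not_not]
      by_cases hks : k = s
      · exact Or.inl hks
      · exact Or.inr (hclique s hsK k hk (Ne.symm hks))
    have hcardM := Finset.card_sdiff_add_card_eq_card hMsub
    have hle := h.ndeg_add_card_le (u := s) (v := v) (M := M)
      ⟨w, by simp [hM, mem_nbrs, hvw, hn, hsw]⟩ (by rintro rfl; exact hKI _ hsK hvI)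
      (by
        intro y hy
        simp only [hM, Finset.mem_sdiff, mem_nbrs, Finset.mem_insert, not_or] at hy
        exact ⟨hy.1, hy.2.2, hy.2.1⟩)
      (fun h => absurd h (hKI _ hsK))
      (fun _ => by
        have := Finset.card_le_card hKM
        have h3 : (nbrs H v).card = ndeg H v := rfl
        omega)
    have hsub : (nbrs H v \ M).erase s ∪ I ⊆ nbrs H s := by
      intro y hy
      rcases Finset.mem_union.1 hy with hy | hy
      · simp only [hM, Finset.mem_erase, Finset.mem_sdiff, mem_nbrs, Finset.mem_insert] at hy
        rw [mem_nbrs]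
        tauto
      · exact mem_nbrs.2 (hSI s hs y hy)
    have hdisj : Disjoint ((nbrs H v \ M).erase s) I := by
      rw [Finset.disjoint_left]
      intro y hy hyI
      have := Finset.mem_sdiff.1 (Finset.mem_erase.1 hy).2
      exact h.notMem_of_adj hvI (mem_nbrs.1 this.1) hyI
    have h1 := Finset.card_le_card hsub
    rw [Finset.card_union_of_disjoint hdisj, h.1.1] at h1
    have h2 := Finset.pred_card_le_card_erase (s := nbrs H v \ M) (a := s)
    have h3 : (nbrs H v).card = ndeg H v := rfl
    have h4 : (nbrs H s).card = ndeg H s := rfl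
    omega
  rcases Nat.lt_or_ge I₁.card 2 with hlt | hge
  · -- `K ∪ I₁` is a clique with an independent complement
    have hone : ∀ u ∈ I₁, ∀ v ∈ I₁, u = v := by
      rw [← Finset.card_le_one]; omega
    refine ⟨K ∪ I₁, S, ?_, ?_, hSK.trans Finset.subset_union_left, hSb, ?_⟩
    · intro u hu v hv huv
      rcases Finset.mem_union.1 hu with hu | hu <;> rcases Finset.mem_union.1 hv with hv | hv
      · exact hclique u hu v hv huv
      · exact (hI₁K v hv u hu).symm
      · exact hI₁K u hu v hv
      · exact absurd (hone u hu v hv) huv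
    · intro u hu v hv huv
      simp only [Finset.mem_union, not_or] at hu hv
      rcases hout u hu.1 v hv.1 huv with h1 | h1
      · exact hu.2 h1.1
      · exact hv.2 h1.1
    · intro s hs
      rcases I₁.eq_empty_or_nonempty with he | ⟨v, hv⟩
      · rw [← h.1.1]
        refine Finset.card_le_card fun x hx => ?_
        simp only [Finset.mem_inter, mem_nbrs, hSI s hs x hx, he, Finset.mem_compl, true_and,
          Finset.union_empty]
        exact fun hxK => hKI x hxK hx
      · obtain ⟨hvI, w, hvw, hw⟩ := (hI₁ v).1 hv
        have hwI := h.notMem_of_adj hvI hvw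
        have hsub : insert w (I.erase v) ⊆ nbrs H s ∩ (K ∪ I₁)ᶜ := by
          intro x hx
          simp only [Finset.mem_inter, mem_nbrs, Finset.mem_compl, Finset.mem_union, not_or]
          rcases Finset.mem_insert.1 hx with rfl | hx
          · exact ⟨hSJ v hv x hw hvw s hs, hw, fun hx => hwI ((hI₁ x).1 hx).1⟩
          · have hx' := Finset.mem_erase.1 hx
            exact ⟨hSI s hs x hx'.2, fun hxK => hKI x hxK hx'.2,
              fun hx1 => hx'.1 (hone x hx1 v hv)⟩
        have h1 := Finset.card_le_card hsub
        rw [Finset.card_insert_of_notMem (fun hw => hwI (Finset.mem_erase.1 hw).2)] at h1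
        have h2 := Finset.card_erase_add_one hvI
        rw [h.1.1] at h2
        omega
  · -- exchanging `I₁` for common neighbours of `S` contradicts maximality
    exfalso
    obtain ⟨v, hv, v', hv', hvv'⟩ := Finset.one_lt_card.1 hge
    have hvI := ((hI₁ v).1 hv).1
    have hbig : K.card + I₁.card ≤ ndeg H v := (h.exceptional hc hI₁ hv).2
    have hdom' := (h.exceptional hc hI₁ hv').1
    have hJ₁ : I₁.card ≤ (nbrs H v \ K).card := by
      have := Finset.card_sdiff_add_card (nbrs H v) K
      have h2 : (nbrs H v ∪ K).card = ndeg H v := by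
        rw [Finset.union_eq_left.2 fun k hk => mem_nbrs.2 (hI₁K v hv k hk)]
        rfl
      omega
    obtain ⟨J', hJ'sub, hJ'card⟩ := Finset.exists_subset_card_eq hJ₁
    have hJ' : ∀ w ∈ J', w ∉ K ∧ w ∉ I ∧ H.Adj v w := by
      intro w hw
      have := Finset.mem_sdiff.1 (hJ'sub hw)
      have hvw := mem_nbrs.1 this.1
      exact ⟨this.2, h.notMem_of_adj hvI hvw, hvw⟩
    have hdeg : ∀ w ∈ J', b + 1 ≤ ndeg H w := by
      intro w hw
      obtain ⟨hwK, hwI, hvw⟩ := hJ' w hw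
      have hsub : insert v S ⊆ nbrs H w := by
        intro x hx
        rcases Finset.mem_insert.1 hx with rfl | hx
        · exact mem_nbrs.2 hvw.symm
        · exact mem_nbrs.2 (hSJ v hv w hwK hvw x hx).symm
      have := Finset.card_le_card hsub
      rw [Finset.card_insert_of_notMem fun hx => hKI v (hSK hx) hvI, hSb] at this
      exact this
    have hI₁I : I₁ ⊆ I := fun x hx => ((hI₁ x).1 hx).1
    have hdisj : Disjoint (I \ I₁) J' := by
      rw [Finset.disjoint_left]
      exact fun x hx hx' => (hJ' x hx').2.1 (Finset.mem_sdiff.1 hx).1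
    have hnotK : ∀ x ∈ (I \ I₁) ∪ J', x ∉ K ∧ x ∉ I₁ := by
      intro x hx
      rcases Finset.mem_union.1 hx with hx | hx
      · have := Finset.mem_sdiff.1 hx
        exact ⟨fun hk => hKI x hk this.1, this.2⟩
      · exact ⟨(hJ' x hx).1, fun h1 => (hJ' x hx).2.1 (hI₁I h1)⟩
    have hnew : IsMaxPair b H ((I \ I₁) ∪ J') := by
      refine ⟨⟨?_, ?_, ?_⟩, h.2⟩
      · rw [Finset.card_union_of_disjoint hdisj, hJ'card, Finset.card_sdiff_add_card_eq_card hI₁I,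
          h.1.1]
      · intro x hx y hy hxy
        rcases hout x (hnotK x hx).1 y (hnotK y hy).1 hxy with h1 | h1
        · exact (hnotK x hx).2 h1.1
        · exact (hnotK y hy).2 h1.1
      · intro x hx
        rcases Finset.mem_union.1 hx with hx | hx
        · exact h.1.2.2 x (Finset.mem_sdiff.1 hx).1
        · exact (Nat.le_succ b).trans (hdeg x hx)
    obtain ⟨w, hw⟩ : J'.Nonempty := by
      rw [← Finset.card_pos]; omega
    obtain ⟨hwK, hwI, hvw⟩ := hJ' w hw
    have hle := hnew.ndeg_add_card_le (u := v') (v := w) (M := {v}) ⟨v, by simp⟩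
      (by rintro rfl; exact hwI ((hI₁ _).1 hv').1)
      (by
        intro y hy
        rw [Finset.mem_singleton] at hy
        subst hy
        exact ⟨hvw.symm, h.1.2.1 v' (hI₁I hv') y hvI, hvv'⟩)
      (fun hx => absurd hv' (hnotK v' hx).2) (fun _ => by simpa using hdeg w hw)
    have := hdom' w hwI hwK
    simp at hle
    omega

end IsMaxPair

theorem star_bound_of_le {α y c a : ℝ} (hα : 17 / 100 ≤ α) (hα' : α ≤ 23 / 100)
    (hy : 17 / 25 ≤ y) (hy' : y ≤ 701 / 1000) (ha : 0 ≤ a) (ha2 : a ^ 2 = y + α ^ 2)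
    (hc : 1 / 2 ≤ c) (hca : c ≤ a - α) :
    c ^ 4 + 3 * c ^ 2 * ((y - c ^ 2) / 2) + ((y - c ^ 2) / 2) ^ 2 ≤
      c * (α ^ 3 + (y - α ^ 2) * a) := by
  obtain ⟨m, rfl⟩ : ∃ m, a = m + α := ⟨a - α, by ring⟩
  have hym : y = m ^ 2 + 2 * α * m := by linarith
  subst hym
  have hm1 : m ≤ 7 / 10 := by nlinarith
  have hm2 : 31 / 50 ≤ m := by nlinarith
  have hcm : c ≤ m := by linarith
  have key : m * (m + 2 * α) ^ 2 ≤ (3 * m ^ 2 + 8 * α * m - m * c - c ^ 2) * c := by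
    have h0 : m * (m + 2 * α) ^ 2 ≤
        (3 * m ^ 2 + 8 * α * m - m * (1 / 2) - (1 / 2) ^ 2) * (1 / 2) := by
      have h1 : m + 2 * α ≤ 1131 / 1000 := by nlinarith
      have h2 : 0 ≤ m * (m + 2 * α) := by nlinarith
      nlinarith [mul_le_mul_of_nonneg_left h1 h2]
    have h1 : m * (m + 2 * α) ^ 2 ≤ (3 * m ^ 2 + 8 * α * m - m * m - m ^ 2) * m := by
      nlinarith [mul_nonneg (mul_nonneg (by linarith : (0 : ℝ) ≤ m) (by linarith : 0 ≤ α))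
        (by linarith : 0 ≤ m - α)]
    have h2 : 0 ≤ (c - 1 / 2) * (m - c) * (c + 2 * m + 1 / 2) := by
      have : 0 ≤ (c - 1 / 2) * (m - c) := mul_nonneg (by linarith) (by linarith)
      exact mul_nonneg this (by linarith)
    have h3 := mul_le_mul_of_nonneg_left h0 (by linarith : 0 ≤ m - c)
    have h4 := mul_le_mul_of_nonneg_left h1 (by linarith : 0 ≤ c - 1 / 2)
    have hpos : 0 < m - 1 / 2 := by linarith
    refine le_of_mul_le_mul_left ?_ hpos
    nlinarith [mul_nonneg h2 hpos.le]
  have : 0 ≤ (m - c) * m * ((3 * m ^ 2 + 8 * α * m - m * c - c ^ 2) * c - m * (m + 2 * α) ^ 2) := by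
    have : 0 ≤ (m - c) * m := mul_nonneg (by linarith) (by linarith)
    exact mul_nonneg this (by linarith)
  have hm0 : 0 < m := by linarith
  refine le_of_mul_le_mul_left ?_ hm0
  nlinarith

theorem star_bound_of_ge {α y c a ρ : ℝ} (hα : 17 / 100 ≤ α) (hα' : α ≤ 23 / 100)
    (hy : 17 / 25 ≤ y) (hy' : y ≤ 701 / 1000) (ha : 0 ≤ a) (ha2 : a ^ 2 = y + α ^ 2)
    (hca : a - α ≤ c)
    (hρ : (c - α) * (ρ - 2 * α ^ 3 - (c + α) * ((y - c ^ 2) / 2 - α ^ 2)) ≤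
      ((y - c ^ 2) / 2 - α ^ 2) ^ 2) :
    c ^ 3 + 2 * c * ((y - c ^ 2) / 2) + ρ ≤ α ^ 3 + (y - α ^ 2) * a := by
  obtain ⟨m, rfl⟩ : ∃ m, a = m + α := ⟨a - α, by ring⟩
  have hym : y = m ^ 2 + 2 * α * m := by linarith
  subst hym
  have hm1 : m ≤ 7 / 10 := by nlinarith
  have hm2 : 31 / 50 ≤ m := by nlinarith
  obtain ⟨z, rfl⟩ : ∃ z, c = m + z := ⟨c - m, by ring⟩
  have hz : 0 ≤ z := by linarith
  have hM : -2 * α ^ 2 * (m - α) + z * (-m ^ 2 / 2 + 2 * α * m + α ^ 2 / 2) - m * z ^ 2 -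
      z ^ 3 / 4 ≤ 0 := by
    have h1 : -m ^ 2 / 2 + 2 * α * m + α ^ 2 / 2 ≤ 3 / 20 := by nlinarith
    have h2 := mul_le_mul_of_nonneg_left h1 hz
    have h3 : (0 : ℝ) ≤ z ^ 3 := by positivity
    have h4 : (1 : ℝ) / 50 ≤ 2 * α ^ 2 * (m - α) := by nlinarith
    nlinarith [sq_nonneg (z - 12 / 100), mul_nonneg (sub_nonneg.2 hm2) (sq_nonneg z)]
  have hpos : 0 < m + z - α := by linarith
  refine le_of_mul_le_mul_left ?_ hpos
  nlinarith [mul_nonneg hz (neg_nonneg.2 hM)]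

theorem star_bound_of_lt_half {α y c a : ℝ} (hα : 17 / 100 ≤ α) (hα' : α ≤ 23 / 100)
    (hy : 17 / 25 ≤ y) (hy' : y ≤ 701 / 1000) (ha : 0 ≤ a) (ha2 : a ^ 2 = y + α ^ 2)
    (hc : 0 ≤ c) (hc' : c ≤ 1 / 2) :
    (1 - c) * (c ^ 3 + 2 * c * ((y - c ^ 2) / 2)) + (1 - c) ^ 2 * ((y - c ^ 2) / 2) +
      ((y - c ^ 2) / 2) ^ 2 ≤ (1 - c) * (α ^ 3 + (y - α ^ 2) * a) := by
  have hl : 8419 / 10000 + 583 / 1000 * (y + α ^ 2 - 7089 / 10000) ≤ a := by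
    refine abs_le_of_sq_le_sq' ?_ ha |>.2
    rw [ha2]
    nlinarith [mul_nonneg (by nlinarith : 0 ≤ y + α ^ 2 - 7089 / 10000)
      (by nlinarith : 0 ≤ 7539 / 10000 - (y + α ^ 2))]
  have hA : 548 / 1000 + 122 / 100 * (y - 17 / 25) ≤ α ^ 3 + (y - α ^ 2) * a := by
    have h1 : 0 ≤ y - α ^ 2 := by nlinarith
    have h2 := mul_le_mul_of_nonneg_left hl h1
    have h3 : α ^ 2 ≤ (23 / 100) ^ 2 := by nlinarith
    have h4 : α ^ 4 ≤ (23 / 100) ^ 4 := pow_le_pow_left₀ (by linarith) hα' 4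
    have h5 : 0 ≤ (23 / 100 - α) * (α - 17 / 100) :=
      mul_nonneg (by linarith) (by linarith)
    have h6 : (23 / 100) ^ 3 - α ^ 3 ≤ 4286 / 10000 * ((23 / 100) ^ 2 - α ^ 2) := by
      nlinarith [mul_nonneg h5 (by linarith : 0 ≤ α)]
    nlinarith [sq_nonneg (y - 17 / 25)]
  have h1 := mul_le_mul_of_nonneg_left hA (by linarith : 0 ≤ 1 - c)
  refine le_trans ?_ h1
  have h7 : 0 ≤ (y - 17 / 25) * (701 / 1000 - y) := mul_nonneg (by linarith) (by linarith)
  have h8 : 0 ≤ c * (1 / 2 - c) := mul_nonneg hc (by linarith)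
  nlinarith [sq_nonneg (c - 47 / 100), sq_nonneg (c ^ 2 - 2 * c), mul_nonneg h8 hc,
    mul_nonneg (sub_nonneg.2 hy) hc, mul_nonneg (sub_nonneg.2 hy') hc,
    mul_nonneg (sub_nonneg.2 hy') h8, mul_nonneg (sub_nonneg.2 hy) h8]

/-- The bound on the normalised sum of squared degrees of a split graph whose clique has size `c`,
where `t` counts the edges leaving the clique and `ρ` is the sum of squares of their degrees. -/
theorem star_bound {α y c t ρ : ℝ} (hα : 17 / 100 ≤ α) (hα' : α ≤ 23 / 100)
    (hy : 17 / 25 ≤ y) (hy' : y ≤ 701 / 1000) (hc : 0 ≤ c) (ht : c ^ 2 + 2 * t = y)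
    (h₁ : 1 / 2 ≤ c → c * ρ ≤ c ^ 2 * t + t ^ 2)
    (h₂ : c ≤ 1 / 2 → (1 - c) * ρ ≤ (1 - c) ^ 2 * t + t ^ 2)
    (h₃ : 1 + α ≤ 2 * c →
      (c - α) * (ρ - 2 * α ^ 3 - (c + α) * (t - α ^ 2)) ≤ (t - α ^ 2) ^ 2) :
    c ^ 3 + 2 * c * t + ρ ≤ α ^ 3 + (y - α ^ 2) * √(y + α ^ 2) := by
  have hu : 0 ≤ y + α ^ 2 := by positivity
  have ha := Real.sqrt_nonneg (y + α ^ 2)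
  have ha2 := Real.sq_sqrt hu
  set a := √(y + α ^ 2)
  obtain rfl : t = (y - c ^ 2) / 2 := by linarith
  rcases le_total c (1 / 2) with hc2 | hc2
  · have hpos : 0 < 1 - c := by linarith
    refine le_of_mul_le_mul_left ?_ hpos
    have := star_bound_of_lt_half hα hα' hy hy' ha ha2 hc hc2
    linarith [h₂ hc2]
  rcases le_total c (a - α) with hca | hca
  · have hpos : 0 < c := by linarith
    refine le_of_mul_le_mul_left ?_ hpos
    have := star_bound_of_le hα hα' hy hy' ha ha2 hc2 hca
    linarith [h₁ hc2]
  · refine star_bound_of_ge hα hα' hy hy' ha ha2 hca (h₃ ?_)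
    have : (1 + 3 * α) / 2 ≤ a := by
      refine (abs_le_of_sq_le_sq' ?_ ha).2
      rw [ha2]
      nlinarith
    linarith

theorem sum_sum_sub_sq {ι : Type*} (X : Finset ι) (f : ι → ℝ) :
    ∑ s ∈ X, ∑ t ∈ X, (f s - f t) ^ 2 =
      2 * (X.card * ∑ s ∈ X, f s ^ 2 - (∑ s ∈ X, f s) ^ 2) := by
  have h : ∀ s t, (f s - f t) ^ 2 = f s ^ 2 + f t ^ 2 - 2 * (f s * f t) := fun s t => by ring
  simp only [h, Finset.sum_add_distrib, Finset.sum_sub_distrib, ← Finset.mul_sum,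
    ← Finset.sum_mul, Finset.sum_const, nsmul_eq_mul]
  ring

/-- In a bipartite graph the sum of squared degrees is largest when all vertices of the larger part
have the same neighbours or none. -/
theorem card_mul_sum_sq_le {ι κ : Type*} (X : Finset ι) (Y : Finset κ) (r : ι → κ → ℝ)
    (hr : ∀ s y, r s y ^ 2 = r s y) (hXY : Y.card ≤ X.card) :
    X.card * (∑ s ∈ X, (∑ y ∈ Y, r s y) ^ 2 + ∑ y ∈ Y, (∑ s ∈ X, r s y) ^ 2) ≤
      X.card ^ 2 * ∑ s ∈ X, ∑ y ∈ Y, r s y + (∑ s ∈ X, ∑ y ∈ Y, r s y) ^ 2 := by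
  have h1 := sum_sum_sub_sq X fun s => ∑ y ∈ Y, r s y
  have h2 : ∑ y ∈ Y, ∑ s ∈ X, ∑ t ∈ X, (r s y - r t y) ^ 2 =
      2 * (X.card * ∑ s ∈ X, ∑ y ∈ Y, r s y - ∑ y ∈ Y, (∑ s ∈ X, r s y) ^ 2) := by
    simp only [sum_sum_sub_sq, hr, ← Finset.mul_sum, Finset.sum_sub_distrib]
    rw [Finset.sum_comm]
  have h3 : ∑ s ∈ X, ∑ t ∈ X, (∑ y ∈ Y, r s y - ∑ y ∈ Y, r t y) ^ 2 ≤
      Y.card * ∑ y ∈ Y, ∑ s ∈ X, ∑ t ∈ X, (r s y - r t y) ^ 2 := by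
    rw [Finset.sum_comm (s := Y), Finset.mul_sum]
    refine Finset.sum_le_sum fun s _ => ?_
    rw [Finset.sum_comm (s := Y), Finset.mul_sum]
    refine Finset.sum_le_sum fun t _ => ?_
    rw [← Finset.sum_sub_distrib]
    exact sq_sum_le_card_mul_sum_sq
  have h4 : 0 ≤ ∑ y ∈ Y, ∑ s ∈ X, ∑ t ∈ X, (r s y - r t y) ^ 2 :=
    Finset.sum_nonneg fun y _ => Finset.sum_nonneg fun s _ => Finset.sum_nonneg fun t _ =>
      sq_nonneg _
  have h5 : (Y.card : ℝ) ≤ X.card := by exact_mod_cast hXY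
  have h6 := mul_le_mul_of_nonneg_right h5 h4
  rw [h1] at h3
  rw [h2] at h3 h6
  linarith

/-- The bound on the sum of squared degrees of a bipartite graph with a set `S` of vertices of degree
at least `|S|` in its larger part. -/
theorem card_mul_sum_sq_le_of_subset {ι κ : Type*} [DecidableEq ι] (X S : Finset ι) (Y : Finset κ)
    (r : ι → κ → ℝ) (hr : ∀ s y, r s y ^ 2 = r s y) (hS : S ⊆ X)
    (hdeg : ∀ s ∈ S, (S.card : ℝ) ≤ ∑ y ∈ Y, r s y) (hXY : Y.card + S.card ≤ X.card) :
    ((X.card : ℝ) - S.card) * (∑ s ∈ X, (∑ y ∈ Y, r s y) ^ 2 + ∑ y ∈ Y, (∑ s ∈ X, r s y) ^ 2 -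
        2 * (S.card : ℝ) ^ 3 - (X.card + S.card) * (∑ s ∈ X, ∑ y ∈ Y, r s y - (S.card : ℝ) ^ 2)) ≤
      (∑ s ∈ X, ∑ y ∈ Y, r s y - (S.card : ℝ) ^ 2) ^ 2 := by
  have hr0 : ∀ s y, 0 ≤ r s y := fun s y => by rw [← hr]; positivity
  have hr1 : ∀ s y, r s y ≤ 1 := fun s y => by nlinarith [hr s y, hr0 s y]
  have hcard := Finset.card_sdiff_add_card_eq_card hS
  have hcard' : ((X \ S).card : ℝ) = X.card - S.card := by
    rw [← hcard]; push_cast; ring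
  have hbip := card_mul_sum_sq_le (X \ S) Y r hr (by omega)
  have hA : (Y.card : ℝ) + S.card ≤ X.card := by exact_mod_cast hXY
  rw [hcard'] at hbip
  have e1 := Finset.sum_sdiff (f := fun s => (∑ y ∈ Y, r s y) ^ 2) hS
  have e2 := Finset.sum_sdiff (f := fun s => ∑ y ∈ Y, r s y) hS
  have e3 : ∀ y, ∑ s ∈ X, r s y = ∑ s ∈ X \ S, r s y + ∑ s ∈ S, r s y :=
    fun y => (Finset.sum_sdiff (f := fun s => r s y) hS).symm
  have hgS : ∀ y, ∑ s ∈ S, r s y ≤ S.card := fun y => by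
    simpa using Finset.sum_le_card_nsmul S (fun s => r s y) 1 fun s _ => hr1 s y
  have hgS0 : ∀ y, 0 ≤ ∑ s ∈ S, r s y := fun y => Finset.sum_nonneg fun s _ => hr0 s y
  have hg0 : ∀ y, 0 ≤ ∑ s ∈ X \ S, r s y := fun y => Finset.sum_nonneg fun s _ => hr0 s y
  have f1 : ∑ y ∈ Y, (∑ s ∈ X, r s y) ^ 2 ≤ ∑ y ∈ Y, (∑ s ∈ X \ S, r s y) ^ 2 +
      2 * S.card * ∑ s ∈ X \ S, ∑ y ∈ Y, r s y + S.card * ∑ s ∈ S, ∑ y ∈ Y, r s y := by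
    rw [Finset.sum_comm (s := X \ S), Finset.sum_comm (s := S), Finset.mul_sum, Finset.mul_sum,
      ← Finset.sum_add_distrib, ← Finset.sum_add_distrib]
    refine Finset.sum_le_sum fun y _ => ?_
    rw [e3]
    nlinarith [mul_le_mul_of_nonneg_left (hgS y) (hg0 y),
      mul_le_mul_of_nonneg_left (hgS y) (hgS0 y)]
  have hiY : ∀ s, ∑ y ∈ Y, r s y ≤ Y.card := fun s => by
    simpa using Finset.sum_le_card_nsmul Y (fun y => r s y) 1 fun y _ => hr1 s y
  have f2 : ∑ s ∈ S, (∑ y ∈ Y, r s y) ^ 2 ≤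
      (S.card + Y.card) * ∑ s ∈ S, ∑ y ∈ Y, r s y - S.card * (S.card * Y.card) := by
    rw [Finset.mul_sum, ← nsmul_eq_mul S.card, ← Finset.sum_const, ← Finset.sum_sub_distrib]
    refine Finset.sum_le_sum fun s hs => ?_
    nlinarith [mul_nonneg (sub_nonneg.2 (hdeg s hs)) (sub_nonneg.2 (hiY s))]
  have f3 : (S.card : ℝ) ^ 2 ≤ ∑ s ∈ S, ∑ y ∈ Y, r s y := by
    rw [sq, ← nsmul_eq_mul]
    exact Finset.card_nsmul_le_sum _ _ _ hdeg
  have f4 : 0 ≤ ∑ s ∈ X \ S, ∑ y ∈ Y, r s y :=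
    Finset.sum_nonneg fun s _ => Finset.sum_nonneg fun y _ => hr0 s y
  have hY0 : (0 : ℝ) ≤ Y.card := by positivity
  have hS0 : (0 : ℝ) ≤ S.card := by positivity
  rw [← e1, ← e2]
  generalize ∑ s ∈ X \ S, (∑ y ∈ Y, r s y) ^ 2 = A at *
  generalize ∑ s ∈ S, (∑ y ∈ Y, r s y) ^ 2 = B at *
  generalize ∑ y ∈ Y, (∑ s ∈ X \ S, r s y) ^ 2 = C at *
  generalize ∑ y ∈ Y, (∑ s ∈ X, r s y) ^ 2 = D at *
  generalize ∑ s ∈ X \ S, ∑ y ∈ Y, r s y = E at *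
  generalize ∑ s ∈ S, ∑ y ∈ Y, r s y = F at *
  generalize (X.card : ℝ) = x at *
  generalize (Y.card : ℝ) = w at *
  generalize (S.card : ℝ) = b at *
  have hL : 0 ≤ x - b := by linarith
  have g1 : B + b * F ≤ (b + x) * (F - b ^ 2) + 2 * b ^ 3 := by
    nlinarith [mul_le_mul_of_nonneg_right hA (sub_nonneg.2 f3)]
  have g2 : A + B + D - 2 * b ^ 3 - (x + b) * (E + F - b ^ 2) ≤ A + C - (x - b) * E := by
    linarith
  have g3 := mul_le_mul_of_nonneg_left g2 hL
  nlinarith [mul_nonneg f4 (sub_nonneg.2 f3), sq_nonneg (F - b ^ 2)]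

/-- The degree sums of a split graph with clique `K`, in terms of the adjacency between `K` and its
complement. -/
theorem exists_split_degree_sums {V : Type*} [Fintype V] [DecidableEq V] {H : SimpleGraph V}
    {K : Finset V} (hK : ∀ u ∈ K, ∀ v ∈ K, u ≠ v → H.Adj u v)
    (hKc : ∀ u, u ∉ K → ∀ v, v ∉ K → ¬ H.Adj u v) :
    ∃ r : V → V → ℝ, (∀ s y, r s y ^ 2 = r s y) ∧
      (∀ s (A : Finset V), ∑ y ∈ A, r s y = ((nbrs H s ∩ A).card : ℝ)) ∧
      ∑ v, (ndeg H v : ℝ) = K.card * (K.card - 1) + 2 * ∑ s ∈ K, ∑ y ∈ Kᶜ, r s y ∧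
      ∑ v, (ndeg H v : ℝ) ^ 2 =
        K.card * (K.card - 1) ^ 2 + 2 * (K.card - 1) * ∑ s ∈ K, ∑ y ∈ Kᶜ, r s y +
          (∑ s ∈ K, (∑ y ∈ Kᶜ, r s y) ^ 2 + ∑ y ∈ Kᶜ, (∑ s ∈ K, r s y) ^ 2) := by
  classical
  refine ⟨fun s y => if H.Adj s y then 1 else 0, ?_⟩
  generalize hrdef : (fun s y => if H.Adj s y then (1 : ℝ) else 0) = r
  have hr : ∀ s y, r s y ^ 2 = r s y := fun s y => by
    simp only [← hrdef]; split_ifs <;> norm_num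
  have hrsymm : ∀ s y, r s y = r y s := fun s y => by simp only [← hrdef, H.adj_comm]
  have hsum : ∀ s (A : Finset V), ∑ y ∈ A, r s y = ((nbrs H s ∩ A).card : ℝ) := by
    intro s A
    simp only [← hrdef, Finset.sum_boole]
    congr 2
    ext y
    simp [mem_nbrs, and_comm]
  have hdK : ∀ s ∈ K, (ndeg H s : ℝ) = K.card - 1 + ∑ y ∈ Kᶜ, r s y := by
    intro s hs
    have h1 : nbrs H s ∩ K = K.erase s := by
      ext y
      simp only [Finset.mem_inter, mem_nbrs, Finset.mem_erase]
      refine ⟨fun h => ⟨h.1.ne', h.2⟩, fun h => ⟨hK s hs y h.2 h.1.symm, h.2⟩⟩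
    have h2 := Finset.card_inter_add_card_sdiff (nbrs H s) K
    have h3 := Finset.card_erase_add_one hs
    rw [h1, Finset.sdiff_eq_inter_compl] at h2
    have h4 : (nbrs H s).card = ndeg H s := rfl
    rw [hsum, ← h4, ← h2, ← h3]
    push_cast; ring
  have hdc : ∀ s ∈ Kᶜ, (ndeg H s : ℝ) = ∑ y ∈ K, r y s := by
    intro s hs
    have h1 : nbrs H s ∩ K = nbrs H s := by
      refine Finset.inter_eq_left.2 fun y hy => ?_
      by_contra hyK
      exact hKc s (Finset.mem_compl.1 hs) y hyK (mem_nbrs.1 hy)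
    rw [Finset.sum_congr rfl fun y _ => hrsymm y s, hsum, h1]
    rfl
  set τ := ∑ s ∈ K, ∑ y ∈ Kᶜ, r s y with hτ
  set R := ∑ s ∈ K, (∑ y ∈ Kᶜ, r s y) ^ 2 + ∑ y ∈ Kᶜ, (∑ s ∈ K, r s y) ^ 2 with hR
  have hτ' : τ = ∑ s ∈ Kᶜ, ∑ y ∈ K, r y s := Finset.sum_comm
  have hD : ∑ v, (ndeg H v : ℝ) = K.card * (K.card - 1) + 2 * τ := by
    rw [← Finset.sum_add_sum_compl K, Finset.sum_congr rfl hdK, Finset.sum_congr rfl hdc,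
      Finset.sum_add_distrib, Finset.sum_const, nsmul_eq_mul, ← hτ, ← hτ']
    ring
  have hQ : ∑ v, (ndeg H v : ℝ) ^ 2 = K.card * (K.card - 1) ^ 2 + 2 * (K.card - 1) * τ + R := by
    have h1 : ∑ s ∈ K, (ndeg H s : ℝ) ^ 2 = ∑ s ∈ K, (K.card - 1 + ∑ y ∈ Kᶜ, r s y) ^ 2 :=
      Finset.sum_congr rfl fun s hs => by rw [hdK s hs]
    have h2 : ∑ s ∈ Kᶜ, (ndeg H s : ℝ) ^ 2 = ∑ s ∈ Kᶜ, (∑ y ∈ K, r y s) ^ 2 :=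
      Finset.sum_congr rfl fun s hs => by rw [hdc s hs]
    rw [← Finset.sum_add_sum_compl K, h1, h2]
    simp only [add_sq, Finset.sum_add_distrib, Finset.sum_const, nsmul_eq_mul, ← Finset.mul_sum]
    rw [hR, hτ]
    ring
  exact ⟨hr, hsum, hD, hQ⟩

/-- The unnormalised form of `star_bound`. -/
theorem exists_star_bound {n α x k τ R : ℝ} (hn : 1000 ≤ n) (hα₁ : 17 / 100 ≤ α)
    (hα₂ : α ≤ 23 / 100) (hx₁ : 17 / 50 ≤ x) (hx₂ : x ≤ 7 / 20) (hk : k = 0 ∨ 1 ≤ k)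
    (hkn : k ≤ n) (hτ : 0 ≤ τ) (hx : 2 * x * n ^ 2 = k * (k - 1) + 2 * τ)
    (h₁ : n ≤ 2 * k → k * R ≤ k ^ 2 * τ + τ ^ 2)
    (h₂ : 2 * k ≤ n → (n - k) * R ≤ (n - k) ^ 2 * τ + τ ^ 2)
    (h₃ : n + α * n ≤ 2 * k →
      (k - α * n) * (R - 2 * (α * n) ^ 3 - (k + α * n) * (τ - (α * n) ^ 2)) ≤
        (τ - (α * n) ^ 2) ^ 2) :
    ∃ y, 2 * x ≤ y ∧ y ≤ 2 * x + 1 / n ∧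
      k * (k - 1) ^ 2 + 2 * (k - 1) * τ + R ≤
        (α ^ 3 + (y - α ^ 2) * √(y + α ^ 2)) * n ^ 3 := by
  have hn0 : 0 < n := by linarith
  have hn3 : 0 < n ^ 3 := by positivity
  have hn4 : 0 < n ^ 4 := by positivity
  obtain ⟨c, rfl⟩ : ∃ c, k = c * n := ⟨k / n, by field_simp⟩
  obtain ⟨t, rfl⟩ : ∃ t, τ = t * n ^ 2 := ⟨τ / n ^ 2, by field_simp⟩
  obtain ⟨ρ, rfl⟩ : ∃ ρ, R = ρ * n ^ 3 := ⟨R / n ^ 3, by field_simp⟩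
  have hk' : c * n * (c * n - 1) ^ 2 ≤ (c * n) ^ 3 := by
    rcases hk with h | h
    · simp [h]
    · have : (c * n - 1) ^ 2 ≤ (c * n) ^ 2 := pow_le_pow_left₀ (by linarith) (by linarith) 2
      linear_combination (c * n) * this
  have hc0 : 0 ≤ c := by
    refine nonneg_of_mul_nonneg_left ?_ hn0
    rcases hk with h | h <;> linarith
  have hc1 : c ≤ 1 := le_of_mul_le_mul_right (by linarith) hn0
  have hy : c ^ 2 + 2 * t = 2 * x + c / n := by
    refine mul_right_cancel₀ (pow_pos hn0 2).ne' ?_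
    linear_combination -hx - n * div_mul_cancel₀ c hn0.ne'
  have hcn : c / n ≤ 1 / n := by gcongr
  have hn1 : 1 / n ≤ 1 / 1000 := by gcongr
  have hcn0 : 0 ≤ c / n := by positivity
  have hbound : c ^ 3 + 2 * c * t + ρ ≤
      α ^ 3 + (2 * x + c / n - α ^ 2) * √(2 * x + c / n + α ^ 2) := by
    refine star_bound hα₁ hα₂ (by linarith) (by linarith) hc0 hy ?_ ?_ ?_
    · intro h
      refine le_of_mul_le_mul_right ?_ hn4
      linear_combination h₁ (by linear_combination 2 * n * h)
    · intro h
      refine le_of_mul_le_mul_right ?_ hn4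
      linear_combination h₂ (by linear_combination 2 * n * h)
    · intro h
      refine le_of_mul_le_mul_right ?_ hn4
      linear_combination h₃ (by linear_combination n * h)
  refine ⟨2 * x + c / n, by linarith, by linarith, ?_⟩
  refine le_trans ?_ (mul_le_mul_of_nonneg_right hbound hn3.le)
  linear_combination hk' + 2 * hτ

/-- The bound on the sum of squared degrees of a split graph with clique `K`. -/
theorem split_sum_sq_le {V : Type*} [Fintype V] [DecidableEq V] {H : SimpleGraph V}
    {K S : Finset V} (hK : ∀ u ∈ K, ∀ v ∈ K, u ≠ v → H.Adj u v)
    (hKc : ∀ u, u ∉ K → ∀ v, v ∉ K → ¬ H.Adj u v) (hSK : S ⊆ K)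
    (hS : ∀ s ∈ S, S.card ≤ (nbrs H s ∩ Kᶜ).card) {n α x : ℝ} (hn : n = Fintype.card V)
    (hn1 : 1000 ≤ n) (hα : S.card = α * n) (hα₁ : 17 / 100 ≤ α) (hα₂ : α ≤ 23 / 100)
    (hx : ∑ v, (ndeg H v : ℝ) = 2 * x * n ^ 2) (hx₁ : 17 / 50 ≤ x) (hx₂ : x ≤ 7 / 20) :
    ∃ y, 2 * x ≤ y ∧ y ≤ 2 * x + 1 / n ∧
      ∑ v, (ndeg H v : ℝ) ^ 2 ≤ (α ^ 3 + (y - α ^ 2) * √(y + α ^ 2)) * n ^ 3 := by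
  obtain ⟨r, hr, hsum, hD, hQ⟩ := exists_split_degree_sums hK hKc
  have hτ : ∑ s ∈ K, ∑ y ∈ Kᶜ, r s y = ∑ s ∈ Kᶜ, ∑ y ∈ K, r y s := Finset.sum_comm
  have hcc : (Kᶜ.card : ℝ) = n - K.card := by
    rw [Finset.card_compl, Nat.cast_sub (Finset.card_le_univ K), hn]
  rw [hQ]
  refine exists_star_bound hn1 hα₁ hα₂ hx₁ hx₂ ?_ ?_ ?_ (hx.symm.trans hD) ?_ ?_ ?_
  · rcases K.card.eq_zero_or_pos with h | h
    · exact Or.inl (by simp [h])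
    · exact Or.inr (by exact_mod_cast h)
  · rw [hn]
    exact_mod_cast Finset.card_le_univ K
  · exact Finset.sum_nonneg fun s _ => Finset.sum_nonneg fun y _ => by rw [← hr]; positivity
  · intro h
    have h' : Kᶜ.card ≤ K.card := by
      have : (Kᶜ.card : ℝ) ≤ K.card := by linarith
      exact_mod_cast this
    exact card_mul_sum_sq_le K Kᶜ r hr h'
  · intro h
    have h' : K.card ≤ Kᶜ.card := by
      have : (K.card : ℝ) ≤ Kᶜ.card := by linarith
      exact_mod_cast this
    have := card_mul_sum_sq_le Kᶜ K (fun s y => r y s) (fun s y => hr y s) h'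
    rwa [← hτ, add_comm (∑ s ∈ Kᶜ, _), hcc] at this
  · intro h
    have h' : Kᶜ.card + S.card ≤ K.card := by
      have : (Kᶜ.card : ℝ) + S.card ≤ K.card := by linarith
      exact_mod_cast this
    rw [← hα]
    exact card_mul_sum_sq_le_of_subset K S Kᶜ r hr hSK
      (fun s hs => by rw [hsum]; exact_mod_cast hS s hs) h'

theorem add_mul_sqrt_le {α x y : ℝ} (hα₁ : 17 / 100 ≤ α) (hα₂ : α ≤ 23 / 100)
    (hx₁ : 17 / 50 ≤ x) (hxy : 2 * x ≤ y) (hy : y ≤ 1) :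
    α ^ 3 + (y - α ^ 2) * √(y + α ^ 2) ≤
      α ^ 3 + (2 * x - α ^ 2) * √(2 * x + α ^ 2) + 2 * (y - 2 * x) := by
  have h1 : √(y + α ^ 2) ≤ √(2 * x + α ^ 2) + (y - 2 * x) := by
    have ha : 1 / 2 ≤ √(2 * x + α ^ 2) := Real.le_sqrt_of_sq_le (by nlinarith)
    have ha2 := Real.sq_sqrt (by positivity : 0 ≤ 2 * x + α ^ 2)
    refine Real.sqrt_le_iff.2 ⟨by linarith, ?_⟩
    nlinarith [mul_nonneg (sub_nonneg.2 ha) (sub_nonneg.2 hxy), sq_nonneg (y - 2 * x)]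
  have h2 : √(2 * x + α ^ 2) ≤ 1 + α ^ 2 :=
    Real.sqrt_le_iff.2 ⟨by positivity, by nlinarith [sq_nonneg α, sq_nonneg (α ^ 2)]⟩
  have h3 : 0 ≤ y - α ^ 2 := by nlinarith
  have h4 := mul_le_mul_of_nonneg_left h1 h3
  have h5 : √(2 * x + α ^ 2) + (y - α ^ 2) ≤ 2 := by linarith
  nlinarith [mul_le_mul_of_nonneg_right h5 (sub_nonneg.2 hxy)]

/-- The simple graph with edge set `G`. -/
def edgeGraph {n : ℕ} (G : Finset (Finset (Fin n))) : SimpleGraph (Fin n) where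
  Adj u v := u ≠ v ∧ {u, v} ∈ G
  symm := ⟨fun u v h => ⟨h.1.symm, by rw [Finset.pair_comm]; exact h.2⟩⟩
  loopless := ⟨fun _ h => h.1 rfl⟩

theorem ndeg_edgeGraph {n : ℕ} {G : Finset (Finset (Fin n))} (hG : IsGraph2 G) (v : Fin n) :
    ndeg (edgeGraph G) v = gdeg G v := by
  refine Finset.card_bij (fun w _ => {v, w}) ?_ ?_ ?_
  · intro w hw
    have := mem_nbrs.1 hw
    simp [this.2]
  · intro w hw w' hw' h
    have h1 : w ∈ ({v, w'} : Finset (Fin n)) := by rw [← h]; simp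
    have h2 := (mem_nbrs.1 hw).1
    simp only [Finset.mem_insert, Finset.mem_singleton] at h1
    exact h1.resolve_left h2.symm
  · intro e he
    obtain ⟨heG, hve⟩ := Finset.mem_filter.1 he
    obtain ⟨x, y, hxy, rfl⟩ := Finset.card_eq_two.1 (hG e heG)
    simp only [Finset.mem_insert, Finset.mem_singleton] at hve
    rcases hve with rfl | rfl
    · exact ⟨y, mem_nbrs.2 ⟨hxy, heG⟩, rfl⟩
    · exact ⟨x, mem_nbrs.2 ⟨hxy.symm, by rwa [Finset.pair_comm]⟩, Finset.pair_comm _ _⟩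

theorem sum_gdeg {n : ℕ} {G : Finset (Finset (Fin n))} (hG : IsGraph2 G) :
    ∑ v, gdeg G v = 2 * G.card := by
  have h := Finset.sum_card_bipartiteAbove_eq_sum_card_bipartiteBelow
    (s := (Finset.univ : Finset (Fin n))) (t := G) (fun v e => v ∈ e)
  have h2 : ∑ e ∈ G, (Finset.bipartiteBelow (fun v e => v ∈ e) Finset.univ e).card =
      ∑ e ∈ G, 2 := by
    refine Finset.sum_congr rfl fun e he => ?_
    rw [← hG e he]
    congr 1
    ext v
    simp [Finset.bipartiteBelow]
  rw [h2] at h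
  simp only [Finset.sum_const, smul_eq_mul] at h
  rw [mul_comm, ← h]
  rfl

theorem numS2_le {n : ℕ} (G : Finset (Finset (Fin n))) :
    2 * (numS2 G : ℝ) ≤ ∑ v, (gdeg G v : ℝ) ^ 2 := by
  rw [numS2, Nat.cast_sum, Finset.mul_sum]
  refine Finset.sum_le_sum fun v _ => ?_
  rw [Nat.cast_choose_two]
  nlinarith [Nat.cast_nonneg (α := ℝ) (gdeg G v)]

/-- Refined star-counting bound: for every ε > 0 there is N such that
for n ≥ N, a graph G on n vertices with edge density `x = |G|/n² ∈ [17/50, 7/20]` and an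
independent set I of relative size `α = |I|/n ∈ [17/100, 23/100]` all of whose vertices
have degree at least α·n satisfies
`N(S₂,G)/n³ ≤ max{ (α³ + (2x − α²)√(2x + α²))/2, ((1 − 2x)^{3/2} + 4x − 1)/2 } + ε`. -/
theorem star_count_refined_one (ε : ℝ) (hε : 0 < ε) :
    ∃ N : ℕ, ∀ n : ℕ, N ≤ n →
      ∀ (G : Finset (Finset (Fin n))) (I : Finset (Fin n)) (x α : ℝ),
        IsGraph2 G → IndepSet G I →
        x = (G.card : ℝ) / (n : ℝ) ^ 2 → α = (I.card : ℝ) / (n : ℝ) →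
        17 / 50 ≤ x → x ≤ 7 / 20 → 17 / 100 ≤ α → α ≤ 23 / 100 →
        (∀ v ∈ I, α * (n : ℝ) ≤ (gdeg G v : ℝ)) →
        (numS2 G : ℝ) / (n : ℝ) ^ 3 ≤
          max ((α ^ 3 + (2 * x - α ^ 2) * Real.sqrt (2 * x + α ^ 2)) / 2)
            ((Real.sqrt ((1 - 2 * x) ^ 3) + 4 * x - 1) / 2) + ε := by
  refine ⟨max 1000 ⌈1 / ε⌉₊, fun n hN G I x α hG hI hx hα hx₁ hx₂ hα₁ hα₂ hdeg => ?_⟩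
  have hn1 : (1000 : ℝ) ≤ n := by exact_mod_cast (le_max_left _ _).trans hN
  have hnε : 1 / ε ≤ n := (Nat.le_ceil _).trans (by exact_mod_cast (le_max_right _ _).trans hN)
  have hn0 : (0 : ℝ) < n := by linarith
  have hIcard : (I.card : ℝ) = α * n := by rw [hα, div_mul_cancel₀ _ hn0.ne']
  have hGcard : (G.card : ℝ) = x * n ^ 2 := by
    rw [hx, div_mul_cancel₀ _ (pow_pos hn0 2).ne']
  have hpair : IndepPair I.card (edgeGraph G) I := by
    refine ⟨rfl, fun v hv w hw h => hI _ h.2 ?_, fun v hv => ?_⟩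
    · exact Finset.insert_subset hv (Finset.singleton_subset_iff.2 hw)
    · rw [ndeg_edgeGraph hG]
      have := hdeg v hv
      rw [← hIcard] at this
      exact_mod_cast this
  obtain ⟨H, I', hmax, hsum, hsq⟩ := hpair.exists_isMaxPair
  have hsum' : ∑ v, ndeg H v = 2 * G.card := by
    rw [hsum, ← sum_gdeg hG]
    exact Finset.sum_congr rfl fun v _ => ndeg_edgeGraph hG v
  have hcore : I.card ≤ (core H I').card := by
    refine hmax.le_card_core ?_ ?_
    · rw [Fintype.card_fin]
      have : (2 * I.card : ℝ) ≤ n := by rw [hIcard]; nlinarith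
      exact_mod_cast this
    · rw [Fintype.card_fin, hsum']
      have : (4 * I.card * n : ℝ) < 2 * G.card + 5 * I.card ^ 2 := by
        rw [hIcard, hGcard]
        have : 4 * α < 2 * x + 5 * α ^ 2 := by nlinarith
        nlinarith [mul_lt_mul_of_pos_right this (pow_pos hn0 2)]
      exact_mod_cast this
  have hI2 : 2 ≤ I.card := by
    have : (2 : ℝ) ≤ I.card := by rw [hIcard]; nlinarith
    exact_mod_cast this
  obtain ⟨K, S, hK, hKc, hSK, hS, hSdeg⟩ := hmax.exists_split hI2 hcore
  obtain ⟨y, hy₁, hy₂, hy⟩ := split_sum_sq_le (n := n) (α := α) (x := x) hK hKc hSK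
    (by rwa [hS]) (by simp) hn1 (by rw [hS, hIcard]) hα₁ hα₂
    (by rw [mul_assoc, ← hGcard]; exact_mod_cast hsum') hx₁ hx₂
  have hS2 : 2 * (numS2 G : ℝ) ≤ ∑ v, (ndeg H v : ℝ) ^ 2 := by
    refine (numS2_le G).trans ?_
    simp only [← ndeg_edgeGraph hG]
    exact_mod_cast hsq
  have hinv : 1 / (n : ℝ) ≤ ε := by
    rw [div_le_iff₀ hn0]
    rwa [div_le_iff₀' hε] at hnε
  have hinv' : 1 / (n : ℝ) ≤ 1 / 1000 := by gcongr
  have hlip := add_mul_sqrt_le hα₁ hα₂ hx₁ hy₁ (by linarith)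
  refine le_trans ?_ (add_le_add_left (le_max_left _ _) ε)
  rw [div_le_iff₀ (by positivity)]
  have : (numS2 G : ℝ) ≤ ((α ^ 3 + (y - α ^ 2) * √(y + α ^ 2)) / 2) * n ^ 3 := by linarith
  refine this.trans (mul_le_mul_of_nonneg_right ?_ (by positivity))
  linarith
end

section
/- For every ε > 0 there exists an integer N₀ such that for every 3-graph H on n ≥ N₀ vertices and every vertex v ∈ V(H), setting x := d_H(v)/n², one has d_{2,H}(v)/n³ ≤ max{ (1 − 2x)^{3/2} + 6x − 1 , (2x)^{3/2} + 2x } + ε. -/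
/-- A 3-graph: every edge is a 3-element subset of the vertex set `Fin n`. -/
def Is3Graph {n : ℕ} (H : Finset (Finset (Fin n))) : Prop := ∀ e ∈ H, e.card = 3

/-- The shadow of a 3-graph: the pairs contained in at least one edge. -/
def shadow3 {n : ℕ} (H : Finset (Finset (Fin n))) : Finset (Finset (Fin n)) :=
  Finset.univ.filter fun e => e.card = 2 ∧ ∃ E ∈ H, e ⊆ E

/-- The codegree of a pair `e`: the number of vertices `v` with `e ∪ {v} ∈ H`. -/
def codeg3 {n : ℕ} (H : Finset (Finset (Fin n))) (e : Finset (Fin n)) : ℕ :=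
  (Finset.univ.filter fun v => v ∉ e ∧ insert v e ∈ H).card

/-- The ℓ2-norm of a 3-graph: `‖H‖₂ = ∑_{e ∈ ∂H} d_H(e)²`. -/
def l2norm {n : ℕ} (H : Finset (Finset (Fin n))) : ℕ :=
  ∑ e ∈ shadow3 H, (codeg3 H e) ^ 2

/-- `H − v`: delete the vertex `v` and all edges containing it. -/
def delVert {n : ℕ} (H : Finset (Finset (Fin n))) (v : Fin n) : Finset (Finset (Fin n)) :=
  H.filter fun e => v ∉ e

/-- The ℓ2-norm degree of a vertex: `d_{2,H}(v) = ‖H‖₂ − ‖H − v‖₂`. -/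
noncomputable def d2deg {n : ℕ} (H : Finset (Finset (Fin n))) (v : Fin n) : ℝ :=
  (l2norm H : ℝ) - (l2norm (delVert H v) : ℝ)
/-- The degree of a vertex in a 3-graph: the number of edges containing it. -/
def vdeg3 {n : ℕ} (H : Finset (Finset (Fin n))) (v : Fin n) : ℕ :=
  (H.filter fun e => v ∈ e).card

open Finset

/-- The sharp asymptotic upper bound for the sum of squared degrees of a graph of order `n` and
degree sum `c`. -/
noncomputable def degSqBound (n c : ℝ) : ℝ :=
  max (Real.sqrt (c ^ 3)) (2 * c * n - n ^ 3 + Real.sqrt ((n ^ 2 - c) ^ 3))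

theorem sqrt_cube {c : ℝ} (hc : 0 ≤ c) : Real.sqrt (c ^ 3) = Real.sqrt c ^ 3 := by
  rw [Real.sqrt_eq_iff_mul_self_eq (by positivity) (by positivity)]
  have := Real.sq_sqrt hc
  calc c ^ 3 = (Real.sqrt c ^ 2) ^ 3 := by rw [this]
    _ = Real.sqrt c ^ 3 * Real.sqrt c ^ 3 := by ring

theorem quasiStar_le_quasiClique {n c a s : ℝ} (ha0 : 0 ≤ a) (ha : a ^ 2 = c)
    (hs : s ^ 2 = n ^ 2 - c) (h : 2 * s ^ 2 ≤ n ^ 2) : 2 * c * n - n ^ 3 + s ^ 3 ≤ a ^ 3 := by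
  refine (abs_le_of_sq_le_sq' ?_ (pow_nonneg ha0 3)).2
  have h1 : (a ^ 3) ^ 2 = (n ^ 2 - s ^ 2) ^ 3 := by
    rw [show n ^ 2 - s ^ 2 = a ^ 2 by linarith]; ring
  have h2 : (0 : ℝ) ≤ (n - s) ^ 2 * s ^ 2 * (n ^ 2 - 2 * s ^ 2) :=
    mul_nonneg (by positivity) (by linarith)
  rw [h1, show c = n ^ 2 - s ^ 2 by linarith]
  linarith [show (n ^ 2 - s ^ 2) ^ 3 - (2 * (n ^ 2 - s ^ 2) * n - n ^ 3 + s ^ 3) ^ 2 =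
    (n - s) ^ 2 * s ^ 2 * (n ^ 2 - 2 * s ^ 2) by ring]

theorem quasiClique_le_quasiStar {n c a s : ℝ} (hs0 : 0 ≤ s) (hsn : s ≤ n) (ha : a ^ 2 = c)
    (hs : s ^ 2 = n ^ 2 - c) (h : n ^ 2 ≤ 2 * s ^ 2) : a ^ 3 ≤ 2 * c * n - n ^ 3 + s ^ 3 := by
  have hc : c = n ^ 2 - s ^ 2 := by linarith
  have h0 : 0 ≤ 2 * c * n - n ^ 3 + s ^ 3 := by
    rw [hc, show 2 * (n ^ 2 - s ^ 2) * n - n ^ 3 + s ^ 3 = (n - s) * (n ^ 2 + s * (n - s)) by ring]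
    have := sub_nonneg.2 hsn
    positivity
  refine (abs_le_of_sq_le_sq' ?_ h0).2
  have h1 : (a ^ 3) ^ 2 = (n ^ 2 - s ^ 2) ^ 3 := by
    rw [show n ^ 2 - s ^ 2 = a ^ 2 by linarith]; ring
  have h2 : (0 : ℝ) ≤ (n - s) ^ 2 * s ^ 2 * (2 * s ^ 2 - n ^ 2) :=
    mul_nonneg (by positivity) (by linarith)
  rw [h1, hc]
  linarith [show (n ^ 2 - s ^ 2) ^ 3 - (2 * (n ^ 2 - s ^ 2) * n - n ^ 3 + s ^ 3) ^ 2 =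
    - ((n - s) ^ 2 * s ^ 2 * (2 * s ^ 2 - n ^ 2)) by ring]

theorem quasiStar_le_succ {n c s t : ℝ} (hs0 : 0 ≤ s) (ht0 : 0 ≤ t) (hsn : s ≤ n) (hc : 0 ≤ c)
    (hs : s ^ 2 = n ^ 2 - c) (ht : t ^ 2 = (n + 1) ^ 2 - c) (h : n ^ 2 ≤ 2 * s ^ 2) :
    2 * c * n - n ^ 3 + s ^ 3 ≤ 2 * c * (n + 1) - (n + 1) ^ 3 + t ^ 3 := by
  have hts : s + 1 ≤ t := (abs_le_of_sq_le_sq' (by nlinarith) ht0).2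
  have htn : t ≤ n + 1 := (abs_le_of_sq_le_sq' (by linarith) (by linarith)).2
  have h35 : 3 * n ≤ 5 * s := (abs_le_of_sq_le_sq' (by nlinarith) (by linarith)).2
  obtain ⟨p, hp⟩ : ∃ p, p = n - s := ⟨_, rfl⟩
  obtain ⟨q, hq⟩ : ∃ q, q = n + s := ⟨_, rfl⟩
  obtain ⟨P, hP⟩ : ∃ P, P = n + 1 - t := ⟨_, rfl⟩
  obtain ⟨Q, hQ⟩ : ∃ Q, Q = n + 1 + t := ⟨_, rfl⟩
  have h1 : p * q = c := by rw [hp, hq]; linarith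
  have h2 : P * Q = c := by rw [hP, hQ]; linarith
  have key : 4 * ((2 * c * (n + 1) - (n + 1) ^ 3 + t ^ 3) - (2 * c * n - n ^ 3 + s ^ 3)) =
      (p - P) * (q * Q - 4 * (p * q) + (P ^ 2 + P * p + p ^ 2)) := by
    rw [show n = (p + q) / 2 by linarith, show s = (q - p) / 2 by linarith,
      show (p + q) / 2 + 1 = (P + Q) / 2 by linarith, show t = (Q - P) / 2 by linarith]
    linear_combination (-3 * Q + q) * h2 + (3 * q - Q + 4 * (p - P)) * h1
  have hq0 : 0 ≤ q := by linarith
  have h3 : 0 ≤ q * (Q - 4 * p) := mul_nonneg hq0 (by linarith)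
  have h4 : 0 ≤ P * p := mul_nonneg (by linarith) (by linarith)
  have h5 : 0 ≤ (p - P) * (q * Q - 4 * (p * q) + (P ^ 2 + P * p + p ^ 2)) :=
    mul_nonneg (by linarith) (by nlinarith [sq_nonneg p, sq_nonneg P])
  linarith

theorem degSqBound_le_succ {n c : ℝ} (hn : 0 ≤ n) (hc : 0 ≤ c) (hcn : c ≤ n ^ 2) :
    degSqBound n c ≤ degSqBound (n + 1) c := by
  have hcn' : 0 ≤ (n + 1) ^ 2 - c := by nlinarith
  have hcn0 : 0 ≤ n ^ 2 - c := by linarith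
  unfold degSqBound
  rw [sqrt_cube hc, sqrt_cube hcn0, sqrt_cube hcn']
  apply max_le (le_max_left _ _)
  rcases le_total (2 * Real.sqrt (n ^ 2 - c) ^ 2) (n ^ 2) with h | h
  · exact le_max_of_le_left (quasiStar_le_quasiClique (Real.sqrt_nonneg _) (Real.sq_sqrt hc)
      (Real.sq_sqrt hcn0) h)
  · refine le_max_of_le_right (quasiStar_le_succ (Real.sqrt_nonneg _) (Real.sqrt_nonneg _) ?_ hc
      (Real.sq_sqrt hcn0) (Real.sq_sqrt hcn') h)
    exact Real.sqrt_le_iff.2 ⟨hn, by linarith⟩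

theorem quasiClique_add_dominating {n c a b : ℝ} (hn : 0 ≤ n) (hcn : c ≤ n ^ 2 - n)
    (ha0 : 0 ≤ a) (hb0 : 0 ≤ b) (ha : a ^ 2 = c) (hb : b ^ 2 = c + 2 * n) (h : n ≤ 2 * a) :
    a ^ 3 + 2 * c + n + n ^ 2 ≤ b ^ 3 := by
  rcases hn.eq_or_lt with rfl | hn'
  · have : a = 0 := by nlinarith
    subst this
    have : c = 0 := by linarith
    subst this
    norm_num
    positivity
  have hn1 : 1 ≤ n := by nlinarith
  have han : a ≤ n - 1 / 2 := (abs_le_of_sq_le_sq' (by nlinarith) (by linarith)).2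
  have hab : a + 1 ≤ b := (abs_le_of_sq_le_sq' (by nlinarith) hb0).2
  have h1 : b ^ 3 - a ^ 3 = (b - a) ^ 3 / 4 + 3 / 4 * ((b ^ 2 - a ^ 2) * (a + b)) := by ring
  rw [show b ^ 2 - a ^ 2 = 2 * n by linarith] at h1
  have h2 : 0 ≤ (b - a) ^ 3 := pow_nonneg (by linarith) 3
  have h3 : 2 * n * (2 * a + 1) ≤ 2 * n * (a + b) :=
    mul_le_mul_of_nonneg_left (by linarith) (by linarith)
  have h4 : 0 ≤ (2 * a - n) * (n - a) := mul_nonneg (by linarith) (by linarith)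
  nlinarith

theorem quasiStar_add_dominating {n c s t : ℝ} (ht0 : 0 ≤ t)
    (hs : s ^ 2 = n ^ 2 - c) (ht : t ^ 2 = n ^ 2 - c + 1) :
    2 * c * n - n ^ 3 + s ^ 3 + 2 * c + n + n ^ 2 ≤
      2 * (c + 2 * n) * (n + 1) - (n + 1) ^ 3 + t ^ 3 := by
  have h1 : s ^ 3 + 1 ≤ t ^ 3 := by
    refine (abs_le_of_sq_le_sq' ?_ (pow_nonneg ht0 3)).2
    have hst : s ≤ s ^ 2 + 1 := by nlinarith [sq_nonneg (s - 1)]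
    calc (s ^ 3 + 1) ^ 2 = s ^ 6 + 2 * s ^ 2 * s + 1 := by ring
      _ ≤ s ^ 6 + (3 * s ^ 2 * s ^ 2 + 3 * s ^ 2) + 1 := by nlinarith [sq_nonneg s, sq_nonneg (s ^ 2)]
      _ = (s ^ 2 + 1) ^ 3 := by ring
      _ = (t ^ 2) ^ 3 := by rw [ht, hs]
      _ = (t ^ 3) ^ 2 := by ring
  linarith

theorem degSqBound_add_dominating {n c : ℝ} (hn : 0 ≤ n) (hc : 0 ≤ c) (hcn : c ≤ n ^ 2 - n) :
    degSqBound n c + 2 * c + n + n ^ 2 ≤ degSqBound (n + 1) (c + 2 * n) := by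
  have hcn0 : 0 ≤ n ^ 2 - c := by linarith
  have hcn1 : 0 ≤ n ^ 2 - c + 1 := by linarith
  have hc2 : 0 ≤ c + 2 * n := by linarith
  unfold degSqBound
  rw [show (n + 1) ^ 2 - (c + 2 * n) = n ^ 2 - c + 1 by ring, sqrt_cube hc, sqrt_cube hcn0,
    sqrt_cube hcn1, sqrt_cube hc2]
  have hstar := quasiStar_add_dominating (Real.sqrt_nonneg _)
    (Real.sq_sqrt hcn0) (Real.sq_sqrt hcn1)
  have ha := Real.sq_sqrt hc
  have hs := Real.sq_sqrt hcn0
  have ha0 := Real.sqrt_nonneg c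
  rcases le_total n (2 * Real.sqrt c) with h | h
  · have hclique := quasiClique_add_dominating hn hcn ha0 (Real.sqrt_nonneg _) ha
      (Real.sq_sqrt hc2) h
    rcases max_cases (Real.sqrt c ^ 3) (2 * c * n - n ^ 3 + Real.sqrt (n ^ 2 - c) ^ 3)
      with h' | h'
    · rw [h'.1]
      exact le_max_of_le_left hclique
    · rw [h'.1]
      exact le_max_of_le_right hstar
  · rw [max_eq_right]
    · exact le_max_of_le_right hstar
    · exact quasiClique_le_quasiStar (Real.sqrt_nonneg _)
        (Real.sqrt_le_iff.2 ⟨hn, by linarith⟩) ha hs (by nlinarith)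

/-- The matrix `a` is the adjacency matrix of a simple graph all of whose edges lie inside `S`. -/
structure IsAdjOn {V : Type*} (S : Finset V) (a : V → V → ℝ) : Prop where
  symm : ∀ u w, a u w = a w u
  diag : ∀ u, a u u = 0
  zero_or_one : ∀ u w, a u w = 0 ∨ a u w = 1
  support : ∀ u w, u ∉ S → a u w = 0

namespace IsAdjOn

variable {V : Type*} {S : Finset V} {a : V → V → ℝ}

theorem nonneg (h : IsAdjOn S a) (u w : V) : 0 ≤ a u w := by
  rcases h.zero_or_one u w with h | h <;> simp [h]

theorem le_one (h : IsAdjOn S a) (u w : V) : a u w ≤ 1 := by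
  rcases h.zero_or_one u w with h | h <;> simp [h]

theorem support_right (h : IsAdjOn S a) (u w : V) (hw : w ∉ S) : a u w = 0 := by
  rw [h.symm, h.support w u hw]

variable [Fintype V]

theorem rowSum_nonneg (h : IsAdjOn S a) (u : V) : 0 ≤ ∑ w, a u w :=
  sum_nonneg fun w _ => h.nonneg u w

theorem rowSum_eq_zero (h : IsAdjOn S a) {u : V} (hu : u ∉ S) : ∑ w, a u w = 0 :=
  sum_eq_zero fun w _ => h.support u w hu

theorem rowSum_le [DecidableEq V] (h : IsAdjOn S a) {u : V} (hu : u ∈ S) :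
    ∑ w, a u w ≤ #S - 1 := by
  have h1 : ∑ w, a u w = ∑ w ∈ S.erase u, a u w := by
    refine (sum_subset (subset_univ _) fun w _ hw => ?_).symm
    rw [mem_erase, not_and_or, not_not] at hw
    rcases hw with rfl | hw
    · exact h.diag w
    · exact h.support_right u w hw
  rw [h1]
  have h2 := sum_le_card_nsmul (S.erase u) (a u) 1 fun w _ => h.le_one u w
  rw [card_erase_of_mem hu, nsmul_eq_mul, mul_one, Nat.cast_sub (card_pos.2 ⟨u, hu⟩)] at h2
  simpa using h2

theorem total_le [DecidableEq V] (h : IsAdjOn S a) : ∑ u, ∑ w, a u w ≤ (#S : ℝ) ^ 2 - #S := by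
  have h1 : ∑ u, ∑ w, a u w = ∑ u ∈ S, ∑ w, a u w :=
    (sum_subset (subset_univ S) fun u _ hu => h.rowSum_eq_zero hu).symm
  have h2 := sum_le_card_nsmul S (fun u => ∑ w, a u w) (#S - 1) fun u hu => h.rowSum_le hu
  rw [nsmul_eq_mul] at h2
  rw [h1]
  linarith

theorem total_nonneg (h : IsAdjOn S a) : 0 ≤ ∑ u, ∑ w, a u w :=
  sum_nonneg fun u _ => h.rowSum_nonneg u

theorem finite_setOf (S : Finset V) : {a : V → V → ℝ | IsAdjOn S a}.Finite := by
  have : (Set.univ.pi fun _ : V => Set.univ.pi fun _ : V => ({0, 1} : Set ℝ)).Finite :=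
    Set.Finite.pi fun _ => Set.Finite.pi fun _ => by simp
  exact this.subset fun a ha u _ w _ => by simpa using ha.zero_or_one u w

theorem exists_swap [DecidableEq V] (h : IsAdjOn S a) {i j k : V} (hi : i ∈ S) (hij : i ≠ j)
    (hik : i ≠ k) (haik : a i k = 0) (hajk : a j k = 1) :
    ∃ b, IsAdjOn S b ∧ ∀ u, ∑ w, b u w =
      ∑ w, a u w + (if u = i then 1 else 0) - (if u = j then 1 else 0) := by
  have hjk : j ≠ k := by
    rintro rfl
    simp [h.diag] at hajk
  have hjS : j ∈ S := by
    by_contra hj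
    simp [h.support j k hj] at hajk
  have hkS : k ∈ S := by
    by_contra hk
    simp [h.support_right j k hk] at hajk
  have haki := (h.symm k i).trans haik
  have hakj := (h.symm k j).trans hajk
  let e : V → V → ℝ := fun p u => if u = p then 1 else 0
  refine ⟨fun u w => a u w + e i u * e k w + e k u * e i w - e j u * e k w - e k u * e j w,
    ⟨fun u w => ?_, fun u => ?_, fun u w => ?_, fun u w hu => ?_⟩, fun u => ?_⟩
  · rw [h.symm u w]; ring
  · have := h.diag u
    simp only [e]
    split_ifs <;> simp_all
  · have := h.zero_or_one u w
    simp only [e]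
    split_ifs <;> simp_all
  · have := h.support u w hu
    simp only [e]
    split_ifs <;> simp_all
  · simp only [sum_add_distrib, sum_sub_distrib, ← mul_sum]
    have he : ∀ p, ∑ w, e p w = 1 := fun p => by simp [e]
    simp only [he]
    simp only [e]
    ring

theorem exists_dominating_or_isolated [DecidableEq V] (h : IsAdjOn S a) (hS : S.Nonempty)
    (hmax : ∀ b, IsAdjOn S b → ∑ u, ∑ w, b u w = ∑ u, ∑ w, a u w →
      ∑ u, (∑ w, b u w) ^ 2 ≤ ∑ u, (∑ w, a u w) ^ 2) :
    ∃ i ∈ S, (∀ k ∈ S, k ≠ i → a i k = 1) ∨ ∀ j, a i j = 0 := by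
  obtain ⟨i, hi, himax⟩ := S.exists_max_image (fun u => ∑ w, a u w) hS
  by_contra! hne
  obtain ⟨⟨k, hk, hki, haik⟩, -⟩ := hne i hi
  obtain ⟨-, j, hkj⟩ := hne k hk
  have haik := (h.zero_or_one i k).resolve_right haik
  have hajk := (h.symm j k).trans ((h.zero_or_one k j).resolve_left hkj)
  have hjS : j ∈ S := by
    by_contra hj
    simp [h.support j k hj] at hajk
  have hij : i ≠ j := by
    rintro rfl
    simp [haik] at hajk
  obtain ⟨b, hb, hsum⟩ := h.exists_swap hi hij hki.symm haik hajk
  have h1 := hmax b hb (by simp [hsum, sum_add_distrib, sum_sub_distrib])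
  have h2 : ∀ u, (∑ w, b u w) ^ 2 = (∑ w, a u w) ^ 2 +
      ((if u = i then 2 * ∑ w, a u w + 1 else 0) - if u = j then 2 * ∑ w, a u w - 1 else 0) := by
    intro u
    rw [hsum]
    split_ifs with h3 h4 h4
    · exact absurd (h3.symm.trans h4) hij
    all_goals ring
  simp only [h2, sum_add_distrib, sum_sub_distrib, sum_ite_eq', mem_univ, if_true] at h1
  linarith [himax j hjS]

theorem sum_sq_le_of_dominating [DecidableEq V] (h : IsAdjOn S a) {i : V} (hi : i ∈ S)
    (hdom : ∀ k ∈ S, k ≠ i → a i k = 1)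
    (ih : ∀ b, IsAdjOn (S.erase i) b →
      ∑ u, (∑ w, b u w) ^ 2 ≤ degSqBound #(S.erase i) (∑ u, ∑ w, b u w)) :
    ∑ u, (∑ w, a u w) ^ 2 ≤ degSqBound #S (∑ u, ∑ w, a u w) := by
  let b : V → V → ℝ := fun u w => if u = i ∨ w = i then 0 else a u w
  have hb : IsAdjOn (S.erase i) b := by
    refine ⟨fun u w => ?_, fun u => ?_, fun u w => ?_, fun u w hu => ?_⟩
    · simp only [b, h.symm u w, or_comm]
    · simp [b, h.diag]
    · have := h.zero_or_one u w
      simp only [b]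
      split_ifs <;> simp_all
    · have := h.support u w
      simp only [b]
      split_ifs <;> simp_all
  have hcard : (#S : ℝ) = #(S.erase i) + 1 := by
    rw [card_erase_of_mem hi, Nat.cast_sub (card_pos.2 ⟨i, hi⟩)]
    simp
  have hrow : ∀ u ∈ S.erase i, ∑ w, a u w = ∑ w, b u w + 1 := by
    intro u hu
    have hu' := mem_erase.1 hu
    have : ∀ w, a u w = b u w + if w = i then 1 else 0 := by
      intro w
      have := (h.symm u i).trans (hdom u hu'.2 hu'.1)
      simp only [b]
      split_ifs <;> simp_all
    simp [this, sum_add_distrib]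
  have hrowi : ∑ w, a i w = #(S.erase i) := by
    have : ∀ w, a i w = if w ∈ S.erase i then 1 else 0 := by
      intro w
      by_cases hw : w = i
      · simp [hw, h.diag]
      by_cases hwS : w ∈ S
      · simp [hw, hwS, hdom w hwS hw]
      · simp [hwS, h.support_right i w hwS]
    simp only [this, sum_ite_mem, univ_inter, sum_const, nsmul_eq_mul, mul_one]
  have split : ∀ f : V → ℝ, (∀ u, u ∉ S → f u = 0) →
      ∑ u, f u = f i + ∑ u ∈ S.erase i, f u := by
    intro f hf
    rw [add_sum_erase _ _ hi]
    exact (sum_subset (subset_univ S) fun u _ hu => hf u hu).symm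
  have restrict : ∀ f : V → ℝ, (∀ u, u ∉ S.erase i → f u = 0) →
      ∑ u, f u = ∑ u ∈ S.erase i, f u := fun f hf =>
    (sum_subset (subset_univ _) fun u _ hu => hf u hu).symm
  have htot : ∑ u, ∑ w, a u w = ∑ u, ∑ w, b u w + 2 * #(S.erase i) := by
    rw [split _ fun u hu => h.rowSum_eq_zero hu, restrict _ fun u hu => hb.rowSum_eq_zero hu,
      hrowi, sum_congr rfl hrow, sum_add_distrib]
    simp
    ring
  have hsq : ∑ u, (∑ w, a u w) ^ 2 = ∑ u, (∑ w, b u w) ^ 2 + 2 * ∑ u, ∑ w, b u w +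
      #(S.erase i) + (#(S.erase i) : ℝ) ^ 2 := by
    rw [split (fun u => (∑ w, a u w) ^ 2) fun u hu => by simp [h.rowSum_eq_zero hu],
      restrict (fun u => ∑ w, b u w) fun u hu => hb.rowSum_eq_zero hu,
      restrict (fun u => (∑ w, b u w) ^ 2) fun u hu => by simp [hb.rowSum_eq_zero hu], hrowi,
      sum_congr rfl fun u hu => by rw [hrow u hu, add_sq], sum_add_distrib, sum_add_distrib]
    simp [← mul_sum]
    ring
  rw [hsq, htot, hcard]
  have := degSqBound_add_dominating (Nat.cast_nonneg _) hb.total_nonneg hb.total_le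
  linarith [ih b hb]

theorem sum_sq_le_of_isolated [DecidableEq V] (h : IsAdjOn S a) {i : V} (hi : i ∈ S)
    (hiso : ∀ j, a i j = 0)
    (ih : ∀ b, IsAdjOn (S.erase i) b →
      ∑ u, (∑ w, b u w) ^ 2 ≤ degSqBound #(S.erase i) (∑ u, ∑ w, b u w)) :
    ∑ u, (∑ w, a u w) ^ 2 ≤ degSqBound #S (∑ u, ∑ w, a u w) := by
  have hcard : (#S : ℝ) = #(S.erase i) + 1 := by
    rw [card_erase_of_mem hi, Nat.cast_sub (card_pos.2 ⟨i, hi⟩)]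
    simp
  have ha : IsAdjOn (S.erase i) a := by
    refine ⟨h.symm, h.diag, h.zero_or_one, fun u w hu => ?_⟩
    by_cases hui : u = i
    · rw [hui, hiso]
    · exact h.support u w fun huS => hu (mem_erase.2 ⟨hui, huS⟩)
  rw [hcard]
  refine (ih a ha).trans (degSqBound_le_succ (Nat.cast_nonneg _) ha.total_nonneg ?_)
  linarith [ha.total_le, Nat.cast_nonneg (α := ℝ) #(S.erase i)]

/-- The sum of squared degrees of a graph on `S` is at most `degSqBound`. -/
theorem sum_sq_le [DecidableEq V] (h : IsAdjOn S a) :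
    ∑ u, (∑ w, a u w) ^ 2 ≤ degSqBound #S (∑ u, ∑ w, a u w) := by
  induction hn : #S generalizing S a with
  | zero =>
    have h0 : ∀ u, ∑ w, a u w = 0 := fun u => h.rowSum_eq_zero (by simp [card_eq_zero.1 hn])
    simp [h0, degSqBound]
  | succ n ih =>
    obtain ⟨b, ⟨hb, hbsum⟩, hbmax⟩ := Set.exists_max_image
      {b | IsAdjOn S b ∧ ∑ u, ∑ w, b u w = ∑ u, ∑ w, a u w} (fun b => ∑ u, (∑ w, b u w) ^ 2)
      ((finite_setOf S).subset fun b hb => hb.1) ⟨a, h, rfl⟩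
    refine (hbmax a ⟨h, rfl⟩).trans ?_
    rw [← hbsum, ← hn]
    obtain ⟨i, hi, hi'⟩ := hb.exists_dominating_or_isolated (card_pos.1 (by omega))
      fun b' hb' hsum => hbmax b' ⟨hb', hsum.trans hbsum⟩
    have hcard : #(S.erase i) = n := by rw [card_erase_of_mem hi, hn]; rfl
    have ih' : ∀ b, IsAdjOn (S.erase i) b →
        ∑ u, (∑ w, b u w) ^ 2 ≤ degSqBound #(S.erase i) (∑ u, ∑ w, b u w) := fun b hb => by
      have := ih hb hcard
      rwa [hcard]
    rcases hi' with hdom | hiso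
    · exact hb.sum_sq_le_of_dominating hi hdom ih'
    · exact hb.sum_sq_le_of_isolated hi hiso ih'

end IsAdjOn

section Link

variable {n : ℕ} {H : Finset (Finset (Fin n))}

/-- The adjacency matrix of the link graph of `v` in `H`. -/
noncomputable def linkAdj (H : Finset (Finset (Fin n))) (v u w : Fin n) : ℝ :=
  if {v, u, w} ∈ H then 1 else 0

theorem Is3Graph.card_ne (hH : Is3Graph H) {u v w : Fin n} (h : {v, u, w} ∈ H) :
    v ≠ u ∧ v ≠ w ∧ u ≠ w := by
  have h3 := hH _ h
  refine ⟨?_, ?_, ?_⟩ <;> rintro rfl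
  · have := card_le_two (a := v) (b := w)
    simp_all
  · have := card_le_two (a := v) (b := u)
    simp_all [pair_comm u v]
  · have := card_le_two (a := v) (b := u)
    simp_all

theorem Is3Graph.isAdjOn_linkAdj (hH : Is3Graph H) (v : Fin n) :
    IsAdjOn univ (linkAdj H v) := by
  refine ⟨fun u w => ?_, fun u => ?_, fun u w => ?_, fun u w hu => absurd (mem_univ u) hu⟩
  · simp only [linkAdj, pair_comm u w]
  · exact if_neg fun h => (hH.card_ne h).2.2 rfl
  · by_cases h : {v, u, w} ∈ H <;> simp [linkAdj, h]

theorem Is3Graph.sum_linkAdj (hH : Is3Graph H) {u v : Fin n} :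
    ∑ w, linkAdj H v u w = codeg3 H {v, u} := by
  simp only [linkAdj, codeg3, sum_boole]
  congr 2
  ext w
  have hins : insert w {v, u} = ({v, u, w} : Finset (Fin n)) := by
    ext; simp; tauto
  simp only [mem_filter, mem_univ, true_and, hins]
  refine ⟨fun h => ⟨?_, h⟩, fun h => h.2⟩
  have := hH.card_ne h
  simp only [mem_insert, mem_singleton]
  tauto

theorem Is3Graph.sum_linkAdj_self (hH : Is3Graph H) (v : Fin n) : ∑ w, linkAdj H v v w = 0 :=
  sum_eq_zero fun _ _ => if_neg fun h => (hH.card_ne h).1 rfl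

theorem Is3Graph.sum_sum_linkAdj (hH : Is3Graph H) (v : Fin n) :
    ∑ u, ∑ w, linkAdj H v u w = 2 * vdeg3 H v := by
  have h1 : ∀ p : Fin n × Fin n, linkAdj H v p.1 p.2 =
      ∑ E ∈ H with v ∈ E, if E = {v, p.1, p.2} then 1 else 0 := by
    intro p
    rw [sum_ite_eq']
    simp [linkAdj]
  rw [← Fintype.sum_prod_type', sum_congr rfl fun p _ => h1 p, sum_comm, vdeg3]
  have h2 : ∀ E ∈ H.filter (v ∈ ·),
      ∑ p : Fin n × Fin n, (if E = {v, p.1, p.2} then (1 : ℝ) else 0) = 2 := by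
    intro E hE
    obtain ⟨hEH, hvE⟩ := mem_filter.1 hE
    have h3 : (univ.filter fun p : Fin n × Fin n => E = {v, p.1, p.2}) = (E.erase v).offDiag := by
      ext p
      simp only [mem_filter, mem_univ, true_and, mem_offDiag, mem_erase]
      constructor
      · rintro rfl
        have := hH.card_ne hEH
        simp [this.1.symm, this.2.1.symm, this.2.2]
      · rintro ⟨⟨h1, h1'⟩, ⟨h2, h2'⟩, h3⟩
        refine (eq_of_subset_of_card_le ?_ ?_).symm
        · simp [insert_subset_iff, hvE, h1', h2']
        · rw [hH E hEH, card_eq_three.2 ⟨v, p.1, p.2, Ne.symm h1, Ne.symm h2, h3, rfl⟩]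
    rw [sum_boole, h3, offDiag_card, card_erase_of_mem hvE, hH E hEH]
    norm_num
  rw [sum_congr rfl h2, sum_const, nsmul_eq_mul, mul_comm]

theorem codeg3_le (e : Finset (Fin n)) : codeg3 H e ≤ n := by
  simpa [codeg3] using card_le_univ (univ.filter fun v => v ∉ e ∧ insert v e ∈ H)

theorem l2norm_eq_sum_pairs (H : Finset (Finset (Fin n))) :
    l2norm H = ∑ e ∈ powersetCard 2 univ, codeg3 H e ^ 2 := by
  refine sum_subset (fun e he => ?_) fun e he hne => ?_
  · simp only [shadow3, mem_filter, mem_univ, true_and] at he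
    simp [mem_powersetCard, he.1]
  · have he2 := (mem_powersetCard.1 he).2
    have : codeg3 H e = 0 := by
      refine card_eq_zero.2 (filter_eq_empty_iff.2 fun w _ hw => hne ?_)
      simp only [shadow3, mem_filter, mem_univ, true_and]
      exact ⟨he2, _, hw.2, subset_insert _ _⟩
    simp [this]

theorem codeg3_delVert_of_mem {v : Fin n} {e : Finset (Fin n)} (hv : v ∈ e) :
    codeg3 (delVert H v) e = 0 := by
  refine card_eq_zero.2 (filter_eq_empty_iff.2 fun w _ hw => ?_)
  simp [delVert, hv] at hw

theorem codeg3_le_codeg3_delVert_add {v : Fin n} {e : Finset (Fin n)} (hv : v ∉ e) :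
    codeg3 H e ≤ codeg3 (delVert H v) e + if insert v e ∈ H then 1 else 0 := by
  have hsub : (univ.filter fun w => w ∉ e ∧ insert w e ∈ H) ⊆
      (univ.filter fun w => w ∉ e ∧ insert w e ∈ delVert H v) ∪
        if insert v e ∈ H then {v} else ∅ := by
    intro w hw
    simp only [mem_filter, mem_univ, true_and] at hw
    by_cases hwv : w = v
    · subst hwv
      simp [hw.2]
    · simp [delVert, hw.1, hw.2, hv, Ne.symm hwv]
  refine (card_le_card hsub).trans ((card_union_le _ _).trans ?_)
  rw [codeg3]
  split_ifs <;> simp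

theorem sq_codeg3_le {v : Fin n} {e : Finset (Fin n)} (hv : v ∉ e) :
    codeg3 H e ^ 2 ≤ codeg3 (delVert H v) e ^ 2 + if insert v e ∈ H then 2 * n else 0 := by
  have h1 := codeg3_le_codeg3_delVert_add (H := H) hv
  have h2 := codeg3_le (H := H) e
  split_ifs at h1 ⊢
  · rcases h1.lt_or_eq with h | h
    · nlinarith
    · nlinarith
  · simpa using Nat.pow_le_pow_left h1 2

theorem sum_sq_codeg3_pairs (hH : Is3Graph H) (v : Fin n) :
    ∑ e ∈ powersetCard 2 univ with v ∈ e, (codeg3 H e : ℝ) ^ 2 =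
      ∑ u, (∑ w, linkAdj H v u w) ^ 2 := by
  rw [← add_sum_erase univ _ (mem_univ v), hH.sum_linkAdj_self, zero_pow two_ne_zero, zero_add]
  symm
  refine sum_bij (fun u _ => {v, u}) (fun u hu => ?_) (fun u hu w hw huw => ?_) (fun e he => ?_)
    fun u hu => by rw [hH.sum_linkAdj]
  · have := (mem_erase.1 hu).1
    simp [mem_powersetCard, card_pair this.symm]
  · have hu' := (mem_erase.1 hu).1
    have : u ∈ ({v, w} : Finset (Fin n)) := by rw [← huw]; simp
    simpa [hu'] using this
  · obtain ⟨he, hv⟩ := mem_filter.1 he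
    obtain ⟨x, y, hxy, rfl⟩ := card_eq_two.1 (mem_powersetCard.1 he).2
    rcases (by simpa using hv : v = x ∨ v = y) with rfl | rfl
    · exact ⟨y, by simp [hxy.symm], rfl⟩
    · exact ⟨x, by simp [hxy], pair_comm _ _⟩

theorem sum_insert_mem_le (v : Fin n) :
    ∑ e ∈ powersetCard 2 univ with v ∉ e, (if insert v e ∈ H then 2 * n else 0) ≤
      2 * n * vdeg3 H v := by
  rw [← sum_filter, sum_const, smul_eq_mul, mul_comm]
  refine Nat.mul_le_mul_left _ (card_le_card_of_injOn (insert v) (fun e he => ?_) ?_)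
  · simp only [mem_coe, mem_filter] at he
    simp [he.2]
  · intro e he f hf hef
    simp only [mem_coe, mem_filter] at he hf
    rw [← erase_insert he.1.2, hef, erase_insert hf.1.2]

theorem Is3Graph.d2deg_le (hH : Is3Graph H) (v : Fin n) :
    d2deg H v ≤ ∑ u, (∑ w, linkAdj H v u w) ^ 2 + 2 * n * vdeg3 H v := by
  have h1 : ((∑ e ∈ powersetCard 2 univ with v ∉ e, codeg3 H e ^ 2 : ℕ) : ℝ) ≤
      (∑ e ∈ powersetCard 2 univ with v ∉ e, codeg3 (delVert H v) e ^ 2 : ℕ) +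
        2 * n * vdeg3 H v := by
    have := (sum_le_sum fun e he => sq_codeg3_le (H := H) (mem_filter.1 he).2).trans
      ((sum_add_distrib).le.trans (Nat.add_le_add_left (sum_insert_mem_le (H := H) v) _))
    exact_mod_cast this
  have h2 : l2norm (delVert H v) =
      ∑ e ∈ powersetCard 2 univ with v ∉ e, codeg3 (delVert H v) e ^ 2 := by
    rw [l2norm_eq_sum_pairs, ← sum_filter_add_sum_filter_not _ (fun e => v ∈ e),
      sum_eq_zero fun e he => by simp [codeg3_delVert_of_mem (mem_filter.1 he).2], zero_add]
  rw [d2deg, h2, l2norm_eq_sum_pairs, ← sum_filter_add_sum_filter_not _ (fun e => v ∈ e),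
    Nat.cast_add, ← sum_sq_codeg3_pairs hH]
  push_cast at h1 ⊢
  linarith

end Link

theorem degSqBound_scale {n x : ℝ} (hn : 0 ≤ n) :
    degSqBound n (2 * x * n ^ 2) =
      n ^ 3 * max (Real.sqrt ((2 * x) ^ 3)) (Real.sqrt ((1 - 2 * x) ^ 3) + 4 * x - 1) := by
  have h : ∀ y : ℝ, Real.sqrt ((y * n ^ 2) ^ 3) = n ^ 3 * Real.sqrt (y ^ 3) := fun y => by
    rw [show (y * n ^ 2) ^ 3 = (n ^ 3) ^ 2 * y ^ 3 by ring,
      Real.sqrt_mul (by positivity), Real.sqrt_sq (by positivity)]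
  rw [degSqBound, mul_max_of_nonneg _ _ (by positivity), h,
    show n ^ 2 - 2 * x * n ^ 2 = (1 - 2 * x) * n ^ 2 by ring, h]
  congr 1
  ring

/-- For every ε > 0 there is N₀ such that for every 3-graph H on
n ≥ N₀ vertices and every vertex v, with `x = d_H(v)/n²`,
`d_{2,H}(v)/n³ ≤ max{ (1 − 2x)^{3/2} + 6x − 1, (2x)^{3/2} + 2x } + ε`. -/
theorem d2deg_upper_bound (ε : ℝ) (hε : 0 < ε) :
    ∃ N₀ : ℕ, ∀ n : ℕ, N₀ ≤ n →
      ∀ H : Finset (Finset (Fin n)), Is3Graph H →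
        ∀ (v : Fin n) (x : ℝ), x = (vdeg3 H v : ℝ) / (n : ℝ) ^ 2 →
          d2deg H v / (n : ℝ) ^ 3 ≤
            max (Real.sqrt ((1 - 2 * x) ^ 3) + 6 * x - 1)
              (Real.sqrt ((2 * x) ^ 3) + 2 * x) + ε := by
  refine ⟨0, fun n _ H hH v x hx => ?_⟩
  have hn : (0 : ℝ) < n := Nat.cast_pos.2 v.pos
  have hx' : (vdeg3 H v : ℝ) = x * n ^ 2 := by
    rw [hx]
    field_simp
  have h1 := (hH.isAdjOn_linkAdj v).sum_sq_le
  rw [hH.sum_sum_linkAdj, card_univ, Fintype.card_fin, hx', ← mul_assoc,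
    degSqBound_scale hn.le] at h1
  have h2 := hH.d2deg_le v
  rw [hx'] at h2
  have h3 : d2deg H v / (n : ℝ) ^ 3 ≤
      max (Real.sqrt ((2 * x) ^ 3)) (Real.sqrt ((1 - 2 * x) ^ 3) + 4 * x - 1) + 2 * x := by
    rw [div_le_iff₀ (by positivity)]
    linarith
  refine (h3.trans ?_).trans (le_add_of_nonneg_right hε.le)
  rw [max_add, max_comm]
  refine max_le_max ?_ le_rfl
  linarith
end

section
/- Let β ∈ [0, 7/2) be a real number and let 𝒢 = (G₁,…,G₅) be a 𝕂₄-free 5-multigraph on n vertices with |𝒢| ≥ β·C(n+1, 2). Then there exists a set U ⊆ V(𝒢) such that |U| ≥ ((4·|𝒢| − 2β·n·(n+1))/(7 − 2β))^{1/2} and the induced 5-multigraph 𝒢[U] = (G₁[U],…,G₅[U]) satisfies δ(𝒢[U]) ≥ β·|U|. -/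
/-- A 5-multigraph `(G₁,…,G₅)` on `Fin n`: each `G i` is the edge set of a simple graph,
so every edge is a 2-element subset. -/
def IsMulti5 {n : ℕ} (G : Fin 5 → Finset (Finset (Fin n))) : Prop :=
  ∀ i, ∀ e ∈ G i, e.card = 2

/-- The size of a 5-multigraph: `|𝒢| = ∑ᵢ |Gᵢ|`. -/
def msize {n : ℕ} (G : Fin 5 → Finset (Finset (Fin n))) : ℕ := ∑ i, (G i).card

/-- The degree of a vertex in a 5-multigraph: `d_𝒢(v) = ∑ᵢ d_{Gᵢ}(v)`. -/
def mdeg {n : ℕ} (G : Fin 5 → Finset (Finset (Fin n))) (v : Fin n) : ℕ :=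
  ∑ i, ((G i).filter fun e => v ∈ e).card

/-- The multiplicity of a pair `{u,v}`: the number of indices `i` with `uv ∈ Gᵢ`. -/
def mult5 {n : ℕ} (G : Fin 5 → Finset (Finset (Fin n))) (u v : Fin n) : ℕ :=
  (Finset.univ.filter fun i : Fin 5 => ({u, v} : Finset (Fin n)) ∈ G i).card

/-- A 5-multigraph contains `𝕂₄` if there are three distinct indices `i, j, k` and four
distinct vertices `a, b, c, d` with `{ab, cd} ⊆ Gᵢ`, `{ac, bd} ⊆ Gⱼ`, `{ad, bc} ⊆ G_k`. -/
def ContainsK4 {n : ℕ} (G : Fin 5 → Finset (Finset (Fin n))) : Prop :=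
  ∃ i j k : Fin 5, ∃ a b c d : Fin n,
    i ≠ j ∧ i ≠ k ∧ j ≠ k ∧
    a ≠ b ∧ a ≠ c ∧ a ≠ d ∧ b ≠ c ∧ b ≠ d ∧ c ≠ d ∧
    ({a, b} : Finset (Fin n)) ∈ G i ∧ ({c, d} : Finset (Fin n)) ∈ G i ∧
    ({a, c} : Finset (Fin n)) ∈ G j ∧ ({b, d} : Finset (Fin n)) ∈ G j ∧
    ({a, d} : Finset (Fin n)) ∈ G k ∧ ({b, c} : Finset (Fin n)) ∈ G k

section WeightedGraph

variable {V : Type*}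

/-- Twice the total weight inside `S` of a symmetric weight function `w`. -/
def pairSum (w : V → V → ℕ) (S : Finset V) : ℕ := ∑ u ∈ S, ∑ v ∈ S, w u v

lemma pairSum_union [DecidableEq V] {w : V → V → ℕ} (hsymm : ∀ u v, w u v = w v u) {S T : Finset V}
    (hTS : T ⊆ S) :
    pairSum w S = pairSum w T + 2 * ∑ y ∈ S \ T, ∑ t ∈ T, w y t + pairSum w (S \ T) := by
  have hsplit (f : V → ℕ) : ∑ v ∈ S, f v = ∑ v ∈ S \ T, f v + ∑ v ∈ T, f v :=
    (Finset.sum_sdiff hTS).symm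
  have hcross : ∑ u ∈ T, ∑ v ∈ S \ T, w u v = ∑ y ∈ S \ T, ∑ t ∈ T, w y t := by
    rw [Finset.sum_comm]
    exact Finset.sum_congr rfl fun _ _ => Finset.sum_congr rfl fun _ _ => hsymm _ _
  simp only [pairSum, hsplit, Finset.sum_add_distrib, hcross]
  ring

/-- The numerical shadow of being `𝕂₄`-free on four vertices: the weights of the three perfect
matchings do not dominate `(6, 7, 8)` in any order. -/
def MatchingFree (w : V → V → ℕ) : Prop :=
  ∀ a b c d, a ≠ b → a ≠ c → a ≠ d → b ≠ c → b ≠ d → c ≠ d →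
    ¬ (6 ≤ w a b + w c d ∧ 7 ≤ w a c + w b d ∧ 8 ≤ w a d + w b c)

/-- The properties of a vertex-minimal matching-free weighted graph violating
`2 * pairSum w S ≤ 7 * #S ^ 2`. -/
structure DenseCore (w : V → V → ℕ) (S : Finset V) : Prop where
  symm : ∀ u v, w u v = w v u
  self : ∀ u, w u u = 0
  le_five : ∀ u v, w u v ≤ 5
  matchingFree : MatchingFree w
  nonempty : S.Nonempty
  extend : ∀ T ⊆ S, T.Nonempty → 2 * pairSum w T ≤ 7 * T.card ^ 2 →
    ∃ y ∈ S, y ∉ T ∧ 7 * T.card < 2 * ∑ t ∈ T, w y t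

namespace DenseCore

variable {w : V → V → ℕ} {S : Finset V} {a b c d : V}

lemma matchings (h : DenseCore w S) (hab : a ≠ b) (hac : a ≠ c) (had : a ≠ d)
    (hbc : b ≠ c) (hbd : b ≠ d) (hcd : c ≠ d) :
    ¬ (6 ≤ w a b + w c d ∧ 7 ≤ w a c + w b d ∧ 8 ≤ w a d + w b c) ∧
    ¬ (6 ≤ w a b + w c d ∧ 8 ≤ w a c + w b d ∧ 7 ≤ w a d + w b c) ∧
    ¬ (7 ≤ w a b + w c d ∧ 6 ≤ w a c + w b d ∧ 8 ≤ w a d + w b c) ∧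
    ¬ (7 ≤ w a b + w c d ∧ 8 ≤ w a c + w b d ∧ 6 ≤ w a d + w b c) ∧
    ¬ (8 ≤ w a b + w c d ∧ 6 ≤ w a c + w b d ∧ 7 ≤ w a d + w b c) ∧
    ¬ (8 ≤ w a b + w c d ∧ 7 ≤ w a c + w b d ∧ 6 ≤ w a d + w b c) := by
  have h₁ := h.matchingFree a b c d hab hac had hbc hbd hcd
  have h₂ := h.matchingFree a b d c hab had hac hbd hbc hcd.symm
  have h₃ := h.matchingFree a c b d hac hab had hbc.symm hcd hbd
  have h₄ := h.matchingFree a c d b hac had hab hcd hbc.symm hbd.symm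
  have h₅ := h.matchingFree a d b c had hab hac hbd.symm hcd.symm hbc
  have h₆ := h.matchingFree a d c b had hac hab hcd.symm hbd.symm hbc.symm
  rw [h.symm c b] at h₃ h₄ h₆
  rw [h.symm d c] at h₂ h₅ h₆
  rw [h.symm d b] at h₄ h₅ h₆
  omega

lemma exists_adj (h : DenseCore w S) (ha : a ∈ S) : ∃ y ∈ S, y ≠ a ∧ 4 ≤ w y a := by
  obtain ⟨y, hy, hyT, hw⟩ := h.extend {a} (by simpa using ha) (by simp) (by
    simp [pairSum, h.self])
  simp only [Finset.sum_singleton, Finset.card_singleton, Finset.mem_singleton] at hw hyT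
  exact ⟨y, hy, hyT, by omega⟩

variable [DecidableEq V]

lemma exists_adj_pair (h : DenseCore w S) (ha : a ∈ S) (hb : b ∈ S) (hab : a ≠ b) :
    ∃ y ∈ S, y ≠ a ∧ y ≠ b ∧ 8 ≤ w y a + w y b := by
  have hcard : ({a, b} : Finset V).card = 2 := Finset.card_pair hab
  have hsum (f : V → ℕ) : ∑ t ∈ ({a, b} : Finset V), f t = f a + f b := Finset.sum_pair hab
  obtain ⟨y, hy, hyT, hw⟩ := h.extend {a, b} (by simp [Finset.insert_subset_iff, ha, hb])
    (by simp) (by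
      have := h.le_five a b
      simp only [pairSum, hsum, hcard, h.self, h.symm b a]
      omega)
  rw [hsum, hcard] at hw
  simp only [Finset.mem_insert, Finset.mem_singleton, not_or] at hyT
  exact ⟨y, hy, hyT.1, hyT.2, by omega⟩

lemma exists_adj_triple (h : DenseCore w S) (ha : a ∈ S) (hb : b ∈ S) (hc : c ∈ S)
    (hab : a ≠ b) (hac : a ≠ c) (hbc : b ≠ c) :
    ∃ y ∈ S, y ≠ a ∧ y ≠ b ∧ y ≠ c ∧ 11 ≤ w y a + w y b + w y c := by
  have hcard : ({a, b, c} : Finset V).card = 3 := Finset.card_eq_three.2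
    ⟨a, b, c, hab, hac, hbc, rfl⟩
  have hsum (f : V → ℕ) : ∑ t ∈ ({a, b, c} : Finset V), f t = f a + f b + f c := by
    rw [Finset.sum_insert (by simp [hab, hac]), Finset.sum_pair hbc, add_assoc]
  obtain ⟨y, hy, hyT, hw⟩ := h.extend {a, b, c}
    (by simp [Finset.insert_subset_iff, ha, hb, hc]) (by simp) (by
      have := h.le_five a b
      have := h.le_five a c
      have := h.le_five b c
      simp only [pairSum, hsum, hcard, h.self, h.symm b a, h.symm c a, h.symm c b]
      omega)
  rw [hsum, hcard] at hw
  simp only [Finset.mem_insert, Finset.mem_singleton, not_or] at hyT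
  exact ⟨y, hy, hyT.1, hyT.2.1, hyT.2.2, by omega⟩

lemma exists_adj_quadruple (h : DenseCore w S) (ha : a ∈ S) (hb : b ∈ S) (hc : c ∈ S)
    (hd : d ∈ S) (hab : a ≠ b) (hac : a ≠ c) (had : a ≠ d) (hbc : b ≠ c) (hbd : b ≠ d)
    (hcd : c ≠ d) (hle : w a b + w a c + w a d + w b c + w b d + w c d ≤ 28) :
    ∃ y ∈ S, y ≠ a ∧ y ≠ b ∧ y ≠ c ∧ y ≠ d ∧ 15 ≤ w y a + w y b + w y c + w y d := by
  have hcard : ({a, b, c, d} : Finset V).card = 4 := by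
    rw [Finset.card_insert_of_notMem (by simp [hab, hac, had]),
      Finset.card_insert_of_notMem (by simp [hbc, hbd]), Finset.card_pair hcd]
  have hsum (f : V → ℕ) : ∑ t ∈ ({a, b, c, d} : Finset V), f t = f a + f b + f c + f d := by
    rw [Finset.sum_insert (by simp [hab, hac, had]), Finset.sum_insert (by simp [hbc, hbd]),
      Finset.sum_pair hcd, ← add_assoc, ← add_assoc]
  obtain ⟨y, hy, hyT, hw⟩ := h.extend {a, b, c, d}
    (by simp [Finset.insert_subset_iff, ha, hb, hc, hd]) (by simp) (by
      simp only [pairSum, hsum, hcard, h.self, h.symm b a, h.symm c a, h.symm c b, h.symm d a,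
        h.symm d b, h.symm d c]
      omega)
  rw [hsum, hcard] at hw
  simp only [Finset.mem_insert, Finset.mem_singleton, not_or] at hyT
  exact ⟨y, hy, hyT.1, hyT.2.1, hyT.2.2.1, hyT.2.2.2, by omega⟩

lemma triangle_le_fourteen (h : DenseCore w S) (ha : a ∈ S) (hb : b ∈ S) (hc : c ∈ S)
    (hab : a ≠ b) (hac : a ≠ c) (hbc : b ≠ c) : w a b + w a c + w b c ≤ 14 := by
  by_contra hlt
  obtain ⟨y, -, hya, hyb, hyc, hw⟩ := h.exists_adj_triple ha hb hc hab hac hbc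
  have := h.le_five a b
  have := h.le_five a c
  have := h.le_five b c
  have := h.le_five y a
  have := h.le_five y b
  have := h.le_five y c
  have := h.matchings hya hyb hyc hab hac hbc
  omega

/-- A dense core has no four vertices with `ab`, `ac` of weight five, `db`, `dc` of total weight
at least nine, `3 ≤ w b c` and `w d a + w b c ≤ 5`. -/
lemma not_heavy_quadruple (h : DenseCore w S) (ha : a ∈ S) (hb : b ∈ S) (hc : c ∈ S)
    (hd : d ∈ S) (hab : a ≠ b) (hac : a ≠ c) (hda : d ≠ a) (hbc : b ≠ c) (hdb : d ≠ b)
    (hdc : d ≠ c) (wab : w a b = 5) (wac : w a c = 5) (wbc : 3 ≤ w b c)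
    (wdbc : 9 ≤ w d b + w d c) (wle : w d a + w b c ≤ 5) : False := by
  have := h.le_five d b
  have := h.le_five d c
  obtain ⟨y, hy, hya, hyb, hyc, hyd, hw⟩ := h.exists_adj_quadruple ha hb hc hd hab hac hda.symm
    hbc hdb.symm hdc.symm (by rw [h.symm a d, h.symm b d, h.symm c d]; omega)
  have := h.le_five y a
  have := h.le_five y b
  have := h.le_five y c
  have := h.le_five y d
  have := h.triangle_le_fourteen hy ha hb hya hyb hab
  have := h.triangle_le_fourteen hy ha hc hya hyc hac
  have h₁ := h.matchings hya hyb hyc hab hac hbc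
  have h₂ := h.matchings hyd hyb hyc hdb hdc hbc
  have : w y a ≤ 2 := by
    clear h₂
    omega
  have : w y d ≤ 2 := by
    clear h₁
    omega
  omega

lemma not_five_five (h : DenseCore w S) (ha : a ∈ S) (hb : b ∈ S) (hc : c ∈ S)
    (hab : a ≠ b) (hac : a ≠ c) (hbc : b ≠ c) (wab : w a b = 5) (wac : w a c = 5)
    (wbc : 3 ≤ w b c) : False := by
  have := h.triangle_le_fourteen ha hb hc hab hac hbc
  obtain ⟨y, hy, hya, hyb, hyc, hw⟩ := h.exists_adj_triple ha hb hc hab hac hbc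
  have := h.le_five y a
  have := h.le_five y b
  have := h.le_five y c
  have := h.matchings hya hyb hyc hab hac hbc
  have : w y a + w b c ≤ 5 := by omega
  exact h.not_heavy_quadruple ha hb hc hy hab hac hya hbc hyb hyc wab wac wbc (by omega) this

lemma not_four_four (h : DenseCore w S) (ha : a ∈ S) (hb : b ∈ S) (hc : c ∈ S)
    (hab : a ≠ b) (hac : a ≠ c) (hbc : b ≠ c) (wab : 4 ≤ w a b) (wac : 4 ≤ w a c)
    (wbc : 4 ≤ w b c) : False := by
  obtain ⟨y, hy, hya, hyb, hyc, hw⟩ := h.exists_adj_triple ha hb hc hab hac hbc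
  have := h.le_five a b
  have := h.le_five a c
  have := h.le_five b c
  have := h.le_five y a
  have := h.le_five y b
  have := h.le_five y c
  have hm := h.matchings hya hyb hyc hab hac hbc
  have hcases : (w y a = 5 ∧ w y b = 5) ∨ (w y a = 5 ∧ w y c = 5) ∨ (w y b = 5 ∧ w y c = 5) := by
    omega
  rcases hcases with ⟨h₁, h₂⟩ | ⟨h₁, h₂⟩ | ⟨h₁, h₂⟩
  · exact h.not_five_five hy ha hb hya hyb hab h₁ h₂ (by omega)
  · exact h.not_five_five hy ha hc hya hyc hac h₁ h₂ (by omega)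
  · exact h.not_five_five hy hb hc hyb hyc hbc h₁ h₂ (by omega)

lemma triangle_le_twelve (h : DenseCore w S) (ha : a ∈ S) (hb : b ∈ S) (hc : c ∈ S)
    (hab : a ≠ b) (hac : a ≠ c) (hbc : b ≠ c) : w a b + w a c + w b c ≤ 12 := by
  have := h.le_five a b
  have := h.le_five a c
  have := h.le_five b c
  have h₁ := h.not_five_five ha hb hc hab hac hbc
  have h₂ := h.not_five_five hb ha hc hab.symm hbc hac
  have h₃ := h.not_five_five hc ha hb hac.symm hbc.symm hab
  have h₄ := h.not_four_four ha hb hc hab hac hbc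
  rw [h.symm b a] at h₂
  rw [h.symm c a, h.symm c b] at h₃
  by_contra hlt
  simp only [imp_false] at h₁ h₂ h₃ h₄
  omega

lemma sum_quadruple_le (h : DenseCore w S) (ha : a ∈ S) (hb : b ∈ S) (hc : c ∈ S)
    (hd : d ∈ S) (hab : a ≠ b) (hac : a ≠ c) (had : a ≠ d) (hbc : b ≠ c) (hbd : b ≠ d)
    (hcd : c ≠ d) : w a b + w a c + w a d + w b c + w b d + w c d ≤ 28 := by
  have := h.triangle_le_twelve ha hb hc hab hac hbc
  have := h.triangle_le_twelve ha hb hd hab had hbd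
  have := h.triangle_le_twelve ha hc hd hac had hcd
  have := h.triangle_le_twelve hb hc hd hbc hbd hcd
  omega

lemma not_disjoint_fives (h : DenseCore w S) (ha : a ∈ S) (hb : b ∈ S) (hc : c ∈ S)
    (hd : d ∈ S) (hab : a ≠ b) (hac : a ≠ c) (had : a ≠ d) (hbc : b ≠ c) (hbd : b ≠ d)
    (hcd : c ≠ d) (wab : w a b = 5) (wcd : w c d = 5) : False := by
  obtain ⟨y, hy, hya, hyb, hyc, hyd, hw⟩ := h.exists_adj_quadruple ha hb hc hd hab hac had hbc
    hbd hcd (h.sum_quadruple_le ha hb hc hd hab hac had hbc hbd hcd)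
  have := h.triangle_le_twelve hy ha hb hya hyb hab
  have := h.triangle_le_twelve hy hc hd hyc hyd hcd
  omega

lemma not_five_five_four_four (h : DenseCore w S) (ha : a ∈ S) (hb : b ∈ S) (hc : c ∈ S)
    (hd : d ∈ S) (hab : a ≠ b) (hac : a ≠ c) (had : a ≠ d) (hbc : b ≠ c) (hbd : b ≠ d)
    (hcd : c ≠ d) (wab : w a b = 5) (wac : w a c = 5) (wdb : w b d = 4) (wdc : w c d = 4)
    (wad : w a d = 3) : False := by
  obtain ⟨y, hy, hya, hyb, hyc, hyd, hw⟩ := h.exists_adj_quadruple ha hb hc hd hab hac had hbc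
    hbd hcd (h.sum_quadruple_le ha hb hc hd hab hac had hbc hbd hcd)
  have := h.le_five y b
  have := h.le_five y c
  have := h.triangle_le_twelve hy ha hb hya hyb hab
  have := h.triangle_le_twelve hy ha hc hya hyc hac
  have := h.triangle_le_twelve hy hb hd hyb hyd hbd
  have := h.triangle_le_twelve hy hc hd hyc hyd hcd
  have := h.triangle_le_twelve hy ha hd hya hyd had
  have h₁ := h.matchings hya hyb hyc hab hac hbc
  have h₂ := h.matchings hya hyb hyd hab had hbd
  have : w y b = w y c := by omega
  have : w y a = 7 - w y b := by omega
  have : w y d = 8 - w y b := by omega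
  have : 3 ≤ w y b := by omega
  omega

lemma not_five_five_two (h : DenseCore w S) (ha : a ∈ S) (hb : b ∈ S) (hc : c ∈ S)
    (hab : a ≠ b) (hac : a ≠ c) (hbc : b ≠ c) (wab : w a b = 5) (wac : w a c = 5)
    (wbc : w b c = 2) : False := by
  obtain ⟨y, hy, hya, hyb, hyc, hw⟩ := h.exists_adj_triple ha hb hc hab hac hbc
  have := h.le_five y a
  have := h.le_five y b
  have := h.le_five y c
  have h₁ := h.not_disjoint_fives ha hb hc hy hab hac hya.symm hbc hyb.symm hyc.symm wab
  have h₂ := h.not_disjoint_fives ha hc hb hy hac hab hya.symm hbc.symm hyc.symm hyb.symm wac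
  rw [h.symm _ y] at h₁ h₂
  simp only [imp_false] at h₁ h₂
  have := h.triangle_le_twelve hy ha hb hya hyb hab
  have := h.triangle_le_twelve hy ha hc hya hyc hac
  have hm := h.matchings hya hyb hyc hab hac hbc
  refine h.not_five_five_four_four ha hb hc hy hab hac hya.symm hbc hyb.symm hyc.symm wab wac
    ?_ ?_ ?_ <;> rw [h.symm _ y] <;> omega

lemma not_five_four_three (h : DenseCore w S) (ha : a ∈ S) (hb : b ∈ S) (hc : c ∈ S)
    (hab : a ≠ b) (hac : a ≠ c) (hbc : b ≠ c) (wab : w a b = 5) (wac : w a c = 4)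
    (wbc : w b c = 3) : False := by
  obtain ⟨y, hy, hya, hyb, hyc, hw⟩ := h.exists_adj_triple ha hb hc hab hac hbc
  have := h.le_five y a
  have := h.le_five y b
  have := h.le_five y c
  have h₁ := h.not_disjoint_fives ha hb hc hy hab hac hya.symm hbc hyb.symm hyc.symm wab
  rw [h.symm _ y] at h₁
  simp only [imp_false] at h₁
  have := h.triangle_le_twelve hy ha hb hya hyb hab
  have := h.triangle_le_twelve hy hb hc hyb hyc hbc
  have := h.triangle_le_twelve hy ha hc hya hyc hac
  have hm := h.matchings hya hyb hyc hab hac hbc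
  refine h.not_five_five_four_four hb ha hy hc hab.symm hyb.symm hbc hya.symm hac hyc
    (h.symm b a ▸ wab) (h.symm b y ▸ ?_) wac ?_ wbc <;> omega

lemma triangle_lt_twelve (h : DenseCore w S) (ha : a ∈ S) (hb : b ∈ S) (hc : c ∈ S)
    (hab : a ≠ b) (hac : a ≠ c) (hbc : b ≠ c) : w a b + w a c + w b c < 12 := by
  have := h.le_five a b
  have := h.le_five a c
  have := h.le_five b c
  have := h.triangle_le_twelve ha hb hc hab hac hbc
  have h₁ := h.not_five_five_two ha hb hc hab hac hbc
  have h₂ := h.not_five_five_two hb ha hc hab.symm hbc hac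
  have h₃ := h.not_five_five_two hc ha hb hac.symm hbc.symm hab
  have h₄ := h.not_four_four ha hb hc hab hac hbc
  have h₅ := h.not_five_four_three ha hb hc hab hac hbc
  have h₆ := h.not_five_four_three ha hc hb hac hab hbc.symm
  have h₇ := h.not_five_four_three hb ha hc hab.symm hbc hac
  have h₈ := h.not_five_four_three hb hc ha hbc hab.symm hac.symm
  have h₉ := h.not_five_four_three hc ha hb hac.symm hbc.symm hab
  have h₁₀ := h.not_five_four_three hc hb ha hbc.symm hac.symm hab.symm
  simp only [h.symm b a, h.symm c a, h.symm c b, imp_false] at h₁ h₂ h₃ h₄ h₅ h₆ h₇ h₈ h₉ h₁₀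
  by_contra hlt
  have : 2 ≤ w a b := by omega
  have : 2 ≤ w a c := by omega
  interval_cases w a b <;> interval_cases w a c <;> omega

lemma elim (h : DenseCore w S) : False := by
  obtain ⟨a, ha⟩ := h.nonempty
  obtain ⟨b, hb, hba, wba⟩ := h.exists_adj ha
  obtain ⟨c, hc, hcb, hca, wc⟩ := h.exists_adj_pair hb ha hba
  have := h.triangle_lt_twelve hc hb ha hcb hca hba
  omega

end DenseCore

theorem two_mul_pairSum_le [DecidableEq V] {w : V → V → ℕ} (hsymm : ∀ u v, w u v = w v u)
    (hself : ∀ u, w u u = 0) (hle : ∀ u v, w u v ≤ 5) (hfree : MatchingFree w) (S : Finset V) :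
    2 * pairSum w S ≤ 7 * S.card ^ 2 := by
  induction S using Finset.strongInduction with
  | H S ih =>
    by_contra hlt
    refine DenseCore.elim (w := w) (S := S) ⟨hsymm, hself, hle, hfree, ?_, ?_⟩
    · by_contra hS
      rw [Finset.not_nonempty_iff_eq_empty] at hS
      simp [hS, pairSum] at hlt
    · intro T hTS hT hwT
      by_contra! hno
      have hcross : 2 * ∑ y ∈ S \ T, ∑ t ∈ T, w y t ≤ (S \ T).card * (7 * T.card) := by
        rw [Finset.mul_sum]
        refine Finset.sum_le_card_nsmul _ _ _ fun y hy => ?_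
        rw [Finset.mem_sdiff] at hy
        exact hno y hy.1 hy.2
      have hrest := ih (S \ T) (Finset.sdiff_ssubset hTS hT)
      have hcard : S.card = (S \ T).card + T.card := (Finset.card_sdiff_add_card_eq_card hTS).symm
      have hsum := pairSum_union hsymm hTS
      rw [hcard] at hlt
      nlinarith

end WeightedGraph

/-- Greedy choice of distinct representatives of three finite sets. -/
lemma exists_distinct_representatives {α : Type*} [DecidableEq α] {X Y Z : Finset α}
    (hX : 1 ≤ X.card) (hY : 2 ≤ Y.card) (hZ : 3 ≤ Z.card) :
    ∃ i ∈ X, ∃ j ∈ Y, ∃ k ∈ Z, i ≠ j ∧ i ≠ k ∧ j ≠ k := by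
  obtain ⟨i, hi⟩ := Finset.card_pos.1 hX
  obtain ⟨j, hj, hji⟩ := Finset.exists_mem_ne (by omega : 1 < Y.card) i
  obtain ⟨k, hk, hkij⟩ := Finset.exists_mem_notMem_of_card_lt_card
    (lt_of_le_of_lt (Finset.card_le_two (a := i) (b := j)) (by omega : 2 < Z.card))
  simp only [Finset.mem_insert, Finset.mem_singleton, not_or] at hkij
  exact ⟨i, hi, j, hj, k, hk, hji.symm, Ne.symm hkij.1, Ne.symm hkij.2⟩

section Multigraph

variable {n : ℕ} {G : Fin 5 → Finset (Finset (Fin n))}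

lemma mult5_comm (u v : Fin n) : mult5 G u v = mult5 G v u := by
  simp only [mult5, Finset.pair_comm]

lemma mult5_self (hG : IsMulti5 G) (u : Fin n) : mult5 G u u = 0 := by
  simp only [mult5, Finset.card_eq_zero, Finset.filter_eq_empty_iff]
  intro i _ hi
  simpa using hG i _ hi

lemma mult5_le (u v : Fin n) : mult5 G u v ≤ 5 := by
  simpa [mult5] using Finset.card_le_univ (Finset.univ.filter fun i : Fin 5 => {u, v} ∈ G i)

lemma card_common_colours (a b c d : Fin n) :
    mult5 G a b + mult5 G c d ≤
      (Finset.univ.filter fun i : Fin 5 => {a, b} ∈ G i ∧ {c, d} ∈ G i).card + 5 := by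
  rw [Finset.filter_and, mult5, mult5, ← Finset.card_union_add_card_inter, add_comm]
  exact Nat.add_le_add_left ((Finset.card_le_univ _).trans_eq (Fintype.card_fin 5)) _

lemma matchingFree_mult5 (hK4 : ¬ ContainsK4 G) : MatchingFree (mult5 G) := by
  rintro a b c d hab hac had hbc hbd hcd ⟨h₁, h₂, h₃⟩
  have k₁ := card_common_colours (G := G) a b c d
  have k₂ := card_common_colours (G := G) a c b d
  have k₃ := card_common_colours (G := G) a d b c
  obtain ⟨i, hi, j, hj, k, hk, hij, hik, hjk⟩ := exists_distinct_representatives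
    (by omega : 1 ≤ (Finset.univ.filter fun i : Fin 5 => {a, b} ∈ G i ∧ {c, d} ∈ G i).card)
    (by omega : 2 ≤ (Finset.univ.filter fun i : Fin 5 => {a, c} ∈ G i ∧ {b, d} ∈ G i).card)
    (by omega : 3 ≤ (Finset.univ.filter fun i : Fin 5 => {a, d} ∈ G i ∧ {b, c} ∈ G i).card)
  simp only [Finset.mem_filter, Finset.mem_univ, true_and] at hi hj hk
  exact hK4 ⟨i, j, k, a, b, c, d, hij, hik, hjk, hab, hac, had, hbc, hbd, hcd,
    hi.1, hi.2, hj.1, hj.2, hk.1, hk.2⟩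

lemma card_induced_edges_at (hG : IsMulti5 G) {U : Finset (Fin n)} {v : Fin n} (hv : v ∈ U)
    (i : Fin 5) :
    ((G i).filter fun e => v ∈ e ∧ e ⊆ U).card = (U.filter fun u => {v, u} ∈ G i).card := by
  symm
  refine Finset.card_bij (fun u _ => {v, u}) ?_ ?_ ?_
  · intro u hu
    rw [Finset.mem_filter] at hu ⊢
    exact ⟨hu.2, by simp, by simp [Finset.insert_subset_iff, hv, hu.1]⟩
  · intro u hu u' _ huu'
    rw [Finset.mem_filter] at hu
    have hne : u ≠ v := by
      rintro rfl
      simpa using hG i _ hu.2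
    have hmem : u ∈ ({v, u'} : Finset (Fin n)) := huu' ▸ by simp
    simpa [hne] using hmem
  · intro e he
    rw [Finset.mem_filter] at he
    obtain ⟨heG, hve, heU⟩ := he
    obtain ⟨u, hu⟩ := Finset.card_eq_one.1
      (by rw [Finset.card_erase_of_mem hve, hG i e heG] : (e.erase v).card = 1)
    have heq : {v, u} = e := by rw [← hu, Finset.insert_erase hve]
    exact ⟨u, Finset.mem_filter.2 ⟨heU (heq ▸ by simp), heq ▸ heG⟩, heq⟩

lemma sum_mult5_eq_degree (hG : IsMulti5 G) {U : Finset (Fin n)} {v : Fin n} (hv : v ∈ U) :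
    ∑ u ∈ U, mult5 G v u = ∑ i, ((G i).filter fun e => v ∈ e ∧ e ⊆ U).card := by
  simp only [card_induced_edges_at hG hv, mult5, Finset.card_filter]
  exact Finset.sum_comm

lemma pairSum_mult5_univ (hG : IsMulti5 G) : pairSum (mult5 G) Finset.univ = 2 * msize G := by
  simp only [pairSum, sum_mult5_eq_degree hG (Finset.mem_univ _), Finset.subset_univ, and_true]
  rw [Finset.sum_comm, msize, Finset.mul_sum]
  refine Finset.sum_congr rfl fun i _ => ?_
  simp only [Finset.card_filter]
  rw [Finset.sum_comm, mul_comm, ← smul_eq_mul]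
  refine Finset.sum_const_nat fun e he => ?_
  simpa using hG i e he

lemma pairSum_mult5_erase (hG : IsMulti5 G) {U : Finset (Fin n)} {v : Fin n} (hv : v ∈ U) :
    pairSum (mult5 G) U = pairSum (mult5 G) (U.erase v) + 2 * ∑ u ∈ U, mult5 G v u := by
  rw [pairSum_union mult5_comm (Finset.singleton_subset_iff.2 hv),
    Finset.sdiff_singleton_eq_erase, ← Finset.add_sum_erase U _ hv]
  simp only [pairSum, Finset.sum_singleton, mult5_self hG, mult5_comm _ v]
  ring

end Multigraph

/-- A 𝕂₄-free 5-multigraph on n vertices with `|𝒢| ≥ β·C(n+1,2)`,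
where `β ∈ [0, 7/2)`, contains a vertex set U with
`|U| ≥ ((4|𝒢| − 2βn(n+1))/(7 − 2β))^{1/2}` such that every vertex of U has degree at
least `β·|U|` in the induced 5-multigraph `𝒢[U]`. -/
theorem multigraph_large_mindeg (n : ℕ) (β : ℝ) (hβ0 : 0 ≤ β) (hβ1 : β < 7 / 2)
    (G : Fin 5 → Finset (Finset (Fin n))) (hG : IsMulti5 G) (hK4 : ¬ ContainsK4 G)
    (hsize : β * (Nat.choose (n + 1) 2 : ℝ) ≤ (msize G : ℝ)) :
    ∃ U : Finset (Fin n),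
      Real.sqrt ((4 * (msize G : ℝ) - 2 * β * n * (n + 1)) / (7 - 2 * β)) ≤ (U.card : ℝ) ∧
      ∀ v ∈ U, β * (U.card : ℝ) ≤
        ((∑ i, ((G i).filter fun e => v ∈ e ∧ e ⊆ U).card : ℕ) : ℝ) := by
  set w : ℝ := (msize G : ℝ) - β * n * (n + 1) / 2 with hw
  let P : Finset (Fin n) → Prop := fun U =>
    w ≤ (pairSum (mult5 G) U : ℝ) / 2 - β * U.card * (U.card + 1) / 2
  have huniv : P Finset.univ := by
    simp only [P, pairSum_mult5_univ hG, Finset.card_univ, Fintype.card_fin]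
    push_cast
    linarith
  obtain ⟨U, hU⟩ := Set.Finite.exists_minimal (Set.toFinite {U | P U}) ⟨_, huniv⟩
  have hPU : w ≤ (pairSum (mult5 G) U : ℝ) / 2 - β * U.card * (U.card + 1) / 2 := hU.prop
  refine ⟨U, ?_, fun v hv => ?_⟩
  · have hbound : (2 * pairSum (mult5 G) U : ℝ) ≤ 7 * U.card ^ 2 := by
      exact_mod_cast two_mul_pairSum_le mult5_comm (mult5_self hG) mult5_le
        (matchingFree_mult5 hK4) U
    have hβU : 0 ≤ β * U.card := by positivity
    refine Real.sqrt_le_iff.2 ⟨by positivity, ?_⟩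
    rw [div_le_iff₀ (by linarith)]
    nlinarith
  · rw [← sum_mult5_eq_degree hG hv]
    by_contra! hlt
    have herase : P (U.erase v) := by
      have hsum := congrArg (Nat.cast (R := ℝ)) (pairSum_mult5_erase hG hv)
      have hcard : ((U.erase v).card : ℝ) = U.card - 1 := by
        rw [eq_sub_iff_add_eq]
        exact_mod_cast Finset.card_erase_add_one hv
      simp only [P, hcard]
      rw [Nat.cast_add, Nat.cast_mul, Nat.cast_two] at hsum
      nlinarith
    exact Finset.notMem_erase v U (hU.le_of_le herase (Finset.erase_subset v U) hv)
end
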